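/- arXiv:2307.09473 — 2 statements merged into one kernel-verified Lean document; each statement's English description precedes it below -/
import Mathlib

section
/- Let G be a 3-connected planar graph and let a, b be two distinct non-adjacent vertices of G. Then the graph G + {a,b} obtained by inserting the edge {a,b} is planar if and only if a and b lie on the boundary of a common face in a planar embedding of G. -/
open SimpleGraph

/-- The graph `G` with the edge `{a,b}` inserted. -/
def addEdge {W : Type*} (G : SimpleGraph W) (a b : W) : SimpleGraph W :=
  G ⊔ SimpleGraph.fromEdgeSet {s(a, b)}

/-- `u` and `v` are joined by a walk all of whose vertices lie in `A`,
i.e. they are connected in the subgraph induced on `A`. -/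
def ReachableWithin {W : Type*} (G : SimpleGraph W) (A : Set W) (u v : W) : Prop :=
  ∃ p : G.Walk u v, ∀ x ∈ p.support, x ∈ A

/-- The subgraph of `G` induced on the vertex set `A` is connected. -/
def ConnectedOn {W : Type*} (G : SimpleGraph W) (A : Set W) : Prop :=
  A.Nonempty ∧ ∀ ⦃u⦄, u ∈ A → ∀ ⦃v⦄, v ∈ A → ReachableWithin G A u v

/-- The subgraph of `G` induced on `A` is biconnected: connected and without cut vertices. -/
def BiconnectedOn {W : Type*} (G : SimpleGraph W) (A : Set W) : Prop :=
  ConnectedOn G A ∧ ∀ w ∈ A, (A \ {w}).Nonempty → ConnectedOn G (A \ {w})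

/-- `B` is (the vertex set of) a block of `G`: a maximal biconnected subgraph. -/
def IsBlock {W : Type*} (G : SimpleGraph W) (B : Set W) : Prop :=
  BiconnectedOn G B ∧ ∀ B' : Set W, B ⊆ B' → BiconnectedOn G B' → B' = B

/-- The subgraph of `G` induced on `A` is `k`-connected: it has more than `k` vertices
and remains connected after deleting any fewer than `k` vertices. -/
def KConnectedOn {W : Type*} (k : ℕ) (G : SimpleGraph W) (A : Set W) : Prop :=
  (∃ f : Fin (k + 1) → W, Function.Injective f ∧ ∀ i, f i ∈ A) ∧
  ∀ S : Set W, S.Finite → S.ncard < k → ConnectedOn G (A \ S)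

/-- `G` is `k`-connected. -/
def KConnected {W : Type*} (k : ℕ) (G : SimpleGraph W) : Prop :=
  KConnectedOn k G Set.univ

/-- Two walks with common endpoints are internally vertex-disjoint: they share no
vertices other than the endpoints. -/
def IntDisjoint {W : Type*} (G : SimpleGraph W) {s t : W} (p q : G.Walk s t) : Prop :=
  ∀ x, x ∈ p.support → x ∈ q.support → x = s ∨ x = t

/-- The subgraph of `G` induced on the vertex set `A` (with edges only inside `A`),
as a graph on the ambient vertex type. -/
def inducedOn {W : Type*} (G : SimpleGraph W) (A : Set W) : SimpleGraph W :=
  SimpleGraph.fromRel (fun u v => u ∈ A ∧ v ∈ A ∧ G.Adj u v)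

/-- A planar drawing of the part of the graph `G` induced on the vertex set `A`:
vertices are distinct points of the plane and edges are arcs that meet
only at shared endpoints. -/
structure PlanarDrawingOn {W : Type*} (G : SimpleGraph W) (A : Set W) where
  pos : W → ℝ × ℝ
  pos_inj : Set.InjOn pos A
  arc : Sym2 W → Set (ℝ × ℝ)
  arc_spec : ∀ ⦃u v : W⦄, u ∈ A → v ∈ A → G.Adj u v →
    ∃ f : ℝ → ℝ × ℝ, ContinuousOn f (Set.Icc 0 1) ∧ Set.InjOn f (Set.Icc 0 1) ∧
      f 0 = pos u ∧ f 1 = pos v ∧ f '' Set.Icc 0 1 = arc s(u, v)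
  arc_inter : ∀ ⦃e₁ e₂ : Sym2 W⦄, e₁ ∈ G.edgeSet → e₂ ∈ G.edgeSet →
    (∀ x ∈ e₁, x ∈ A) → (∀ x ∈ e₂, x ∈ A) → e₁ ≠ e₂ →
    arc e₁ ∩ arc e₂ ⊆ {p : ℝ × ℝ | ∃ v ∈ A, v ∈ e₁ ∧ v ∈ e₂ ∧ p = pos v}
  pos_arc : ∀ ⦃e : Sym2 W⦄, e ∈ G.edgeSet → (∀ x ∈ e, x ∈ A) →
    ∀ v ∈ A, pos v ∈ arc e → v ∈ e

namespace PlanarDrawingOn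

variable {W : Type*} {G : SimpleGraph W} {A : Set W}

/-- The set of points of the plane used by the drawing. -/
def image (D : PlanarDrawingOn G A) : Set (ℝ × ℝ) :=
  D.pos '' A ∪ ⋃ e ∈ {e : Sym2 W | e ∈ G.edgeSet ∧ ∀ x ∈ e, x ∈ A}, D.arc e

/-- A face of a drawing: a connected component of the complement of the drawing. -/
def IsFace (D : PlanarDrawingOn G A) (F : Set (ℝ × ℝ)) : Prop :=
  ∃ x ∈ D.imageᶜ, F = connectedComponentIn D.imageᶜ x

/-- The outer face of a drawing is its unbounded face. -/
def IsOuterFace (D : PlanarDrawingOn G A) (F : Set (ℝ × ℝ)) : Prop :=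
  D.IsFace F ∧ ¬ Bornology.IsBounded F

end PlanarDrawingOn

/-- A graph is planar if it admits a planar drawing. -/
def SimpleGraph.IsPlanar {W : Type*} (G : SimpleGraph W) : Prop :=
  Nonempty (PlanarDrawingOn G Set.univ)

/-- All vertices of `S` lie on the boundary of a common face in a planar embedding of
the part of `G` induced on `A`. -/
def OnCommonFace {W : Type*} (G : SimpleGraph W) (A : Set W) (S : Set W) : Prop :=
  ∃ (D : PlanarDrawingOn G A) (F : Set (ℝ × ℝ)),
    D.IsFace F ∧ ∀ v ∈ S, D.pos v ∈ frontier F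

section ArcLemmas

/-- `S` is a simple arc from `x` to `y`. -/
def IsArc (S : Set (ℝ × ℝ)) (x y : ℝ × ℝ) : Prop :=
  ∃ f : ℝ → ℝ × ℝ, ContinuousOn f (Set.Icc 0 1) ∧ Set.InjOn f (Set.Icc 0 1) ∧
      f 0 = x ∧ f 1 = y ∧ f '' Set.Icc 0 1 = S

theorem IsArc.of_Icc {a b : ℝ} (hab : a < b) {f : ℝ → ℝ × ℝ}
    (hc : ContinuousOn f (Set.Icc a b)) (hi : Set.InjOn f (Set.Icc a b)) :
    IsArc (f '' Set.Icc a b) (f a) (f b) := by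
  have hpos : 0 < b - a := sub_pos.2 hab
  have himg : (fun t : ℝ => (b - a) * t + a) '' Set.Icc 0 1 = Set.Icc a b := by
    rw [Set.image_affine_Icc' hpos]; congr 1 <;> ring
  have hmaps : Set.MapsTo (fun t : ℝ => (b - a) * t + a) (Set.Icc 0 1) (Set.Icc a b) := by
    rw [← himg]; exact Set.mapsTo_image _ _
  refine ⟨f ∘ (fun t : ℝ => (b - a) * t + a), hc.comp (by fun_prop) hmaps,
    hi.comp ?_ hmaps, by simp, by simp, ?_⟩
  · intro s _ t _ h
    simpa [hpos.ne'] using h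
  · rw [Set.image_comp, himg]

theorem IsArc.symm {S : Set (ℝ × ℝ)} {x y : ℝ × ℝ} (h : IsArc S x y) : IsArc S y x := by
  obtain ⟨f, hc, hi, h0, h1, hS⟩ := h
  have himg : (fun t : ℝ => 1 - t) '' Set.Icc 0 1 = Set.Icc 0 1 := by simp
  have hmaps : Set.MapsTo (fun t : ℝ => 1 - t) (Set.Icc 0 1) (Set.Icc 0 1) := by
    intro t ht; constructor <;> simp <;> linarith [ht.1, ht.2]
  refine ⟨f ∘ (fun t : ℝ => 1 - t), hc.comp (by fun_prop) hmaps,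
    hi.comp ?_ hmaps, by simp [h1], by simp [h0], ?_⟩
  · intro s _ t _ h
    simpa using h
  · rw [Set.image_comp, himg, hS]

theorem IsArc.left_mem {S : Set (ℝ × ℝ)} {x y : ℝ × ℝ} (h : IsArc S x y) : x ∈ S := by
  obtain ⟨f, hc, hi, h0, h1, hS⟩ := h
  rw [← hS, ← h0]
  exact ⟨0, by simp, rfl⟩

theorem IsArc.right_mem {S : Set (ℝ × ℝ)} {x y : ℝ × ℝ} (h : IsArc S x y) : y ∈ S :=
  h.symm.left_mem

theorem IsArc.isCompact {S : Set (ℝ × ℝ)} {x y : ℝ × ℝ} (h : IsArc S x y) : IsCompact S := by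
  obtain ⟨f, hc, hi, h0, h1, hS⟩ := h
  rw [← hS]
  exact isCompact_Icc.image_of_continuousOn hc

theorem IsArc.concat {S T : Set (ℝ × ℝ)} {x y z : ℝ × ℝ} (h : IsArc S x y) (h' : IsArc T y z)
    (hST : S ∩ T ⊆ {y}) : IsArc (S ∪ T) x z := by
  obtain ⟨f, fc, fi, f0, f1, hS⟩ := h
  obtain ⟨g, gc, gi, g0, g1, hT⟩ := h'
  let k : ℝ → ℝ × ℝ := fun t => if t ≤ 1 then f t else g (t - 1)
  have k1 : Set.EqOn k f (Set.Icc 0 1) := fun t ht => if_pos ht.2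
  have k2 : Set.EqOn k (g ∘ fun t => t - 1) (Set.Icc 1 2) := by
    intro t ht
    by_cases h : t ≤ 1
    · have : t = 1 := le_antisymm h ht.1
      subst this
      simp [k, f1, g0]
    · simp [k, h]
  have m2 : Set.MapsTo (fun t : ℝ => t - 1) (Set.Icc 1 2) (Set.Icc 0 1) := by
    intro t ht; constructor <;> simp <;> linarith [ht.1, ht.2]
  have c1 : ContinuousOn k (Set.Icc 0 1) := fc.congr k1
  have c2 : ContinuousOn k (Set.Icc 1 2) := (gc.comp (by fun_prop) m2).congr k2
  have hu : Set.Icc (0:ℝ) 1 ∪ Set.Icc 1 2 = Set.Icc 0 2 :=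
    Set.Icc_union_Icc_eq_Icc (by norm_num) (by norm_num)
  have c : ContinuousOn k (Set.Icc 0 2) := by
    rw [← hu]
    exact c1.union_of_isClosed c2 isClosed_Icc isClosed_Icc
  have key : ∀ s ∈ Set.Icc (0:ℝ) 1, ∀ t ∈ Set.Icc (1:ℝ) 2, k s = k t → s = t := by
    intro s hs t ht hst
    have hs' : k s ∈ S := by rw [k1 hs, ← hS]; exact ⟨s, hs, rfl⟩
    have ht' : k t ∈ T := by rw [k2 ht, ← hT]; exact ⟨t - 1, m2 ht, rfl⟩
    have e : k s = y := hST ⟨hs', hst ▸ ht'⟩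
    have e1 : f s = f 1 := by rw [← k1 hs, e, f1]
    have e2 : g (t - 1) = g 0 := by
      have := k2 ht
      simp only [Function.comp] at this
      rw [← this, ← hst, e, g0]
    have := fi hs (by simp) e1
    have := gi (m2 ht) (by simp) e2
    linarith
  have i : Set.InjOn k (Set.Icc 0 2) := by
    rw [← hu]
    rintro s (hs | hs) t (ht | ht) hst
    · exact fi hs ht (by rw [← k1 hs, ← k1 ht, hst])
    · exact key s hs t ht hst
    · exact (key t ht s hs hst.symm).symm
    · have := gi (m2 hs) (m2 ht) (by have a := k2 hs; have b := k2 ht; simp only [Function.comp] at a b; rw [← a, ← b, hst])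
      linarith
  have := IsArc.of_Icc (by norm_num : (0:ℝ) < 2) c i
  have e0 : k 0 = x := by rw [k1 (by simp), f0]
  have e2 : k 2 = z := by
    rw [k2 (by norm_num), ← g1]; norm_num
  have eI : k '' Set.Icc 0 2 = S ∪ T := by
    rw [← hu, Set.image_union, k1.image_eq, k2.image_eq, hS, Set.image_comp, ← hT]
    congr 2
    rw [Set.image_sub_const_Icc]; norm_num
  rwa [e0, e2, eI] at this

theorem IsArc.of_segment {x y : ℝ × ℝ} (h : x ≠ y) : IsArc (segment ℝ x y) x y := by
  refine ⟨AffineMap.lineMap x y, (AffineMap.lineMap_continuous).continuousOn,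
    (AffineMap.lineMap_injective ℝ h).injOn, by simp, by simp, ?_⟩
  rw [segment_eq_image_lineMap]

theorem IsArc.sub {S : Set (ℝ × ℝ)} {x y r : ℝ × ℝ} (h : IsArc S x y) (hr : r ∈ S) (hry : r ≠ y) :
    ∃ T ⊆ S, IsArc T r y := by
  obtain ⟨f, fc, fi, f0, f1, hS⟩ := h
  rw [← hS] at hr
  obtain ⟨t, ht, rfl⟩ := hr
  have ht1 : t < 1 := lt_of_le_of_ne ht.2 (by rintro rfl; exact hry f1)
  have hsub : Set.Icc t 1 ⊆ Set.Icc 0 1 := Set.Icc_subset_Icc_left ht.1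
  refine ⟨f '' Set.Icc t 1, hS ▸ Set.image_mono hsub, ?_⟩
  have := IsArc.of_Icc ht1 (fc.mono hsub) (fi.mono hsub)
  rwa [f1] at this

/-- The part of an arc after its last point in a closed set. -/
theorem IsArc.lastExit {S B : Set (ℝ × ℝ)} {x y : ℝ × ℝ} (h : IsArc S x y) (hB : IsClosed B)
    (hx : x ∈ B) (hy : y ∉ B) :
    ∃ r T, r ∈ B ∧ T ⊆ S ∧ IsArc T r y ∧ T ∩ B ⊆ {r} ∧ r ∈ closure Bᶜ := by
  obtain ⟨f, fc, fi, f0, f1, hS⟩ := h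
  have hK : IsCompact (Set.Icc (0:ℝ) 1 ∩ f ⁻¹' B) :=
    isCompact_Icc.of_isClosed_subset (fc.preimage_isClosed_of_isClosed isClosed_Icc hB)
      Set.inter_subset_left
  obtain ⟨t, ⟨ht, htB⟩, hmax⟩ := hK.exists_isGreatest ⟨0, by simp, by simpa [f0] using hx⟩
  have ht1 : t < 1 := lt_of_le_of_ne ht.2 (by rintro rfl; exact hy (f1 ▸ htB))
  have hsub : Set.Icc t 1 ⊆ Set.Icc 0 1 := Set.Icc_subset_Icc_left ht.1
  refine ⟨f t, f '' Set.Icc t 1, htB, hS ▸ Set.image_mono hsub, ?_, ?_, ?_⟩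
  · have := IsArc.of_Icc ht1 (fc.mono hsub) (fi.mono hsub)
    rwa [f1] at this
  · rintro _ ⟨⟨s, hs, rfl⟩, hsB⟩
    have : s ≤ t := hmax ⟨hsub hs, hsB⟩
    rw [le_antisymm this hs.1]; rfl
  · have hcl : closure (Set.Ioc t 1) = Set.Icc t 1 := closure_Ioc ht1.ne
    have := ContinuousOn.image_closure (f := f) (s := Set.Ioc t 1)
      (by rw [hcl]; exact fc.mono hsub)
    refine closure_mono ?_ (this ⟨t, by rw [hcl]; simp [ht1.le], rfl⟩)
    rintro _ ⟨s, hs, rfl⟩ hsB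
    have : s ≤ t := hmax ⟨hsub ⟨hs.1.le, hs.2⟩, hsB⟩
    exact absurd hs.1 (not_lt.2 this)

theorem IsArc.join {U S T : Set (ℝ × ℝ)} {x y z : ℝ × ℝ} (h : IsArc S x y) (h' : IsArc T y z)
    (hS : S ⊆ U) (hT : T ⊆ U) (hxz : x ≠ z) : ∃ R ⊆ U, IsArc R x z := by
  by_cases hx : x ∈ T
  · obtain ⟨R, hR, hA⟩ := h'.sub hx hxz
    exact ⟨R, hR.trans hT, hA⟩
  obtain ⟨r, S', hr, hS', hA, hI, -⟩ := h.symm.lastExit h'.isCompact.isClosed h'.left_mem hx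
  by_cases hrz : r = z
  · subst hrz
    exact ⟨S', hS'.trans hS, hA.symm⟩
  obtain ⟨T', hT', hA'⟩ := h'.sub hr hrz
  exact ⟨S' ∪ T', Set.union_subset (hS'.trans hS) (hT'.trans hT),
    hA.symm.concat hA' ((Set.inter_subset_inter_right _ hT').trans hI)⟩

theorem exists_arc_of_isOpen {U : Set (ℝ × ℝ)} (hU : IsOpen U) (hc : IsPreconnected U)
    {x y : ℝ × ℝ} (hx : x ∈ U) (hy : y ∈ U) (hxy : x ≠ y) : ∃ R ⊆ U, IsArc R x y := by
  have key : x = y ∨ ∃ R ⊆ U, IsArc R x y := by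
    refine hc.induction₂ (fun x y => x = y ∨ ∃ R ⊆ U, IsArc R x y) ?_ ?_ ?_ hx hy
    · intro x hx
      obtain ⟨ε, hε, hb⟩ := Metric.isOpen_iff.1 hU x hx
      filter_upwards [mem_nhdsWithin_of_mem_nhds (Metric.ball_mem_nhds x hε)] with y hy
      by_cases hxy : x = y
      · exact Or.inl hxy
      · exact Or.inr ⟨_, ((convex_ball x ε).segment_subset (Metric.mem_ball_self hε) hy).trans hb,
          IsArc.of_segment hxy⟩
    · intro x y z _ _ _ h1 h2
      rcases h1 with rfl | ⟨S, hS, hA⟩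
      · exact h2
      rcases h2 with rfl | ⟨T, hT, hA'⟩
      · exact Or.inr ⟨S, hS, hA⟩
      by_cases hxz : x = z
      · exact Or.inl hxz
      · exact Or.inr (hA.join hA' hS hT hxz)
    · intro x y _ _ h
      rcases h with rfl | ⟨S, hS, hA⟩
      · exact Or.inl rfl
      · exact Or.inr ⟨S, hS, hA.symm⟩
  exact key.resolve_left hxy

/-- Two radii of a ball ending at the boundary meet only in the center, unless equal. -/
theorem radii_inter {c r s p : ℝ × ℝ} {ε : ℝ} (hε : 0 < ε) (hr : Dist.dist r c = ε) (hs : Dist.dist s c = ε)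
    (hp : p ∈ segment ℝ c r) (hp' : p ∈ segment ℝ c s) : p = c ∨ r = s := by
  rw [segment_eq_image_lineMap] at hp hp'
  obtain ⟨t, ht, rfl⟩ := hp
  obtain ⟨u, hu, hpu⟩ := hp'
  have h1 : Dist.dist (AffineMap.lineMap c r t : ℝ × ℝ) c = t * ε := by
    rw [dist_lineMap_left, _root_.dist_comm c r, hr, Real.norm_of_nonneg ht.1]
  have h2 : Dist.dist (AffineMap.lineMap c s u : ℝ × ℝ) c = u * ε := by
    rw [dist_lineMap_left, _root_.dist_comm c s, hs, Real.norm_of_nonneg hu.1]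
  have htu : u = t := by
    rw [hpu, h1] at h2
    exact (mul_right_cancel₀ hε.ne' h2).symm
  subst htu
  by_cases h0 : u = 0
  · left; simp [h0]
  · right
    rw [AffineMap.lineMap_apply_module', AffineMap.lineMap_apply_module'] at hpu
    have := smul_right_injective (ℝ × ℝ) h0 (add_right_cancel hpu)
    exact (sub_left_injective this).symm

theorem radius_end {c r p : ℝ × ℝ} {ε : ℝ} (hε : 0 < ε) (hr : Dist.dist r c = ε) (hs : Dist.dist p c = ε)
    (hp : p ∈ segment ℝ c r) : p = r := by
  rcases radii_inter hε hr hs hp (right_mem_segment ℝ c p) with h | h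
  · subst h; simp at hs; exact absurd hs.symm hε.ne'
  · exact h.symm

theorem radius_subset {c r : ℝ × ℝ} {ε : ℝ} (hε : 0 < ε) (hr : Dist.dist r c = ε) :
    segment ℝ c r ⊆ Metric.closedBall c ε :=
  (convex_closedBall c ε).segment_subset (Metric.mem_closedBall_self hε.le) hr.le

/-- Replace the part of an arc up to its last exit from a ball by a radius. -/
theorem IsArc.reroute {S : Set (ℝ × ℝ)} {x z c : ℝ × ℝ} {ε : ℝ} (hε : 0 < ε) (h : IsArc S x z)
    (hx : x ∈ Metric.closedBall c ε) (hz : z ∉ Metric.closedBall c ε) :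
    ∃ r T, Dist.dist r c = ε ∧ T ⊆ S ∧ r ∈ T ∧ T ∩ Metric.closedBall c ε ⊆ {r} ∧
      IsArc (segment ℝ c r ∪ T) c z := by
  obtain ⟨r, T, hr, hT, hA, hI, hcl⟩ := h.lastExit Metric.isClosed_closedBall hx hz
  have hd : Dist.dist r c = ε := by
    refine le_antisymm hr ?_
    have : closure (Metric.closedBall c ε)ᶜ ⊆ {p | ε ≤ Dist.dist p c} := by
      refine closure_minimal ?_ (isClosed_le continuous_const (continuous_id.dist continuous_const))
      intro p hp
      simp at hp
      exact hp.le
    exact this hcl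
  refine ⟨r, T, hd, hT, hA.left_mem, hI, (IsArc.of_segment ?_).concat hA ?_⟩
  · rintro rfl; simp at hd; exact hε.ne hd
  · intro p hp
    exact hI ⟨hp.2, radius_subset hε hd hp.1⟩

end ArcLemmas

namespace PlanarDrawingOn

variable {V : Type*} {G : SimpleGraph V}

theorem isArc (D : PlanarDrawingOn G Set.univ) {u v : V} (h : G.Adj u v) :
    IsArc (D.arc s(u, v)) (D.pos u) (D.pos v) :=
  D.arc_spec trivial trivial h

theorem isCompact_arc (D : PlanarDrawingOn G Set.univ) {e : Sym2 V} (h : e ∈ G.edgeSet) :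
    IsCompact (D.arc e) := by
  induction e with
  | _ u v => exact (D.isArc h).isCompact

theorem mem_image (D : PlanarDrawingOn G Set.univ) {p : ℝ × ℝ} :
    p ∈ D.image ↔ (∃ v, D.pos v = p) ∨ ∃ e ∈ G.edgeSet, p ∈ D.arc e := by
  simp [image]

theorem isCompact_image [Finite V] (D : PlanarDrawingOn G Set.univ) : IsCompact D.image := by
  refine ((Set.toFinite _).image _).isCompact.union ?_
  exact (Set.toFinite _).isCompact_biUnion fun e he => D.isCompact_arc he.1

/-- The closed ball around the vertex `v` meets only the vertex `v` and edges at `v`. -/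
def GoodBall (D : PlanarDrawingOn G Set.univ) (v : V) (ε : ℝ) : Prop :=
  (∀ w, D.pos w ∈ Metric.closedBall (D.pos v) ε → w = v) ∧
  ∀ e ∈ G.edgeSet, v ∉ e → ∀ p ∈ D.arc e, p ∉ Metric.closedBall (D.pos v) ε

theorem exists_goodBall [Finite V] (D : PlanarDrawingOn G Set.univ) (v : V) :
    ∃ δ > 0, ∀ ε ≤ δ, D.GoodBall v ε := by
  let C : Set (ℝ × ℝ) := D.pos '' {v}ᶜ ∪ ⋃ e ∈ {e : Sym2 V | e ∈ G.edgeSet ∧ v ∉ e}, D.arc e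
  have hC : IsClosed C := by
    refine (((Set.toFinite _).image _).isCompact.union ?_).isClosed
    exact (Set.toFinite _).isCompact_biUnion fun e he => D.isCompact_arc he.1
  have hv : D.pos v ∈ Cᶜ := by
    rintro (⟨w, hw, h⟩ | h)
    · exact hw (D.pos_inj trivial trivial h)
    · simp only [Set.mem_iUnion] at h
      obtain ⟨e, he, h⟩ := h
      exact he.2 (D.pos_arc he.1 (fun _ _ => trivial) v trivial h)
  obtain ⟨δ, hδ, hb⟩ := Metric.nhds_basis_closedBall.mem_iff.1 (hC.isOpen_compl.mem_nhds hv)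
  refine ⟨δ, hδ, fun ε hε => ⟨fun w hw => ?_, fun e he hve p hp hpB => ?_⟩⟩
  · by_contra hne
    exact hb (Metric.closedBall_subset_closedBall hε hw) (Or.inl ⟨w, hne, rfl⟩)
  · refine hb (Metric.closedBall_subset_closedBall hε hpB) (Or.inr ?_)
    simp only [Set.mem_iUnion]
    exact ⟨e, ⟨he, hve⟩, hp⟩

theorem star_step (D : PlanarDrawingOn G Set.univ) {c : V} {ε : ℝ} (hε : 0 < ε)
    (hg : D.GoodBall c ε) {S : Set (ℝ × ℝ)} {x z : ℝ × ℝ} (hS : IsArc S x z)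
    (hx : x ∈ Metric.closedBall (D.pos c) ε) (hz : z ∉ Metric.closedBall (D.pos c) ε)
    (hSK : S ∩ D.image ⊆ {z}) :
    ∃ (D' : PlanarDrawingOn G Set.univ) (S' : Set (ℝ × ℝ)), D'.pos = D.pos ∧
      (∀ e ∈ G.edgeSet, ∀ p ∈ D'.arc e, p ∈ D.arc e ∨ p ∈ Metric.closedBall (D.pos c) ε) ∧
      IsArc S' (D.pos c) z ∧ S' ∩ D'.image ⊆ {D.pos c, z} := by
  classical
  set B := Metric.closedBall (D.pos c) ε with hB
  have hcB : D.pos c ∈ B := Metric.mem_closedBall_self hε.le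
  have hex : ∀ e : Sym2 V, ∃ (r : ℝ × ℝ) (T : Set (ℝ × ℝ)), e ∈ G.edgeSet → c ∈ e →
      (Dist.dist r (D.pos c) = ε ∧ T ⊆ D.arc e ∧ r ∈ T ∧ T ∩ B ⊆ {r} ∧
      ∀ v, e = s(c, v) → IsArc (segment ℝ (D.pos c) r ∪ T) (D.pos c) (D.pos v)) := by
    intro e
    by_cases h : e ∈ G.edgeSet ∧ c ∈ e
    · obtain ⟨he, hce⟩ := h
      obtain ⟨v, rfl⟩ := Sym2.mem_iff_exists.1 hce
      have hadj : G.Adj c v := he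
      obtain ⟨r, T, h1, h2, h3, h4, h5⟩ := (D.isArc hadj).reroute hε hcB
        (fun h => hadj.ne' (hg.1 v h))
      refine ⟨r, T, fun _ _ => ⟨h1, h2, h3, h4, fun w hw => ?_⟩⟩
      rw [Sym2.congr_right.1 hw] at h5
      exact h5
    · exact ⟨0, ∅, fun h1 h2 => absurd ⟨h1, h2⟩ h⟩
  choose r T hrT using hex
  let arc' : Sym2 V → Set (ℝ × ℝ) := fun e =>
    if c ∈ e then segment ℝ (D.pos c) (r e) ∪ T e else D.arc e
  have arc_pos : ∀ {e}, c ∈ e → arc' e = segment ℝ (D.pos c) (r e) ∪ T e := fun h => if_pos h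
  have arc_neg : ∀ {e}, c ∉ e → arc' e = D.arc e := fun h => if_neg h
  -- points of new arcs
  have harc : ∀ e ∈ G.edgeSet, ∀ p ∈ arc' e, p ∈ D.arc e ∨
      (c ∈ e ∧ p ∈ segment ℝ (D.pos c) (r e)) := by
    intro e he p hp
    by_cases hc : c ∈ e
    · rw [arc_pos hc] at hp
      rcases hp with hp | hp
      · exact Or.inr ⟨hc, hp⟩
      · exact Or.inl ((hrT e he hc).2.1 hp)
    · rw [arc_neg hc] at hp
      exact Or.inl hp
  -- points of new arcs in the ball
  have harcB : ∀ e ∈ G.edgeSet, ∀ p ∈ arc' e, p ∈ B →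
      (c ∈ e ∧ p ∈ segment ℝ (D.pos c) (r e)) := by
    intro e he p hp hpB
    by_cases hc : c ∈ e
    · refine ⟨hc, ?_⟩
      rw [arc_pos hc] at hp
      rcases hp with hp | hp
      · exact hp
      · have : p = r e := (hrT e he hc).2.2.2.1 ⟨hp, hpB⟩
        rw [this]; exact right_mem_segment ℝ _ _
    · rw [arc_neg hc] at hp
      exact absurd hpB (hg.2 e he hc p hp)
  have hsegB : ∀ e ∈ G.edgeSet, c ∈ e → segment ℝ (D.pos c) (r e) ⊆ B :=
    fun e he hc => radius_subset hε (hrT e he hc).1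
  let D' : PlanarDrawingOn G Set.univ :=
    { pos := D.pos
      pos_inj := D.pos_inj
      arc := arc'
      arc_spec := by
        intro u v _ _ hadj
        change IsArc (arc' s(u, v)) (D.pos u) (D.pos v)
        by_cases hu : c = u
        · subst hu
          rw [arc_pos (Sym2.mem_mk_left _ _)]
          exact (hrT _ hadj (Sym2.mem_mk_left _ _)).2.2.2.2 v rfl
        by_cases hv : c = v
        · subst hv
          rw [arc_pos (Sym2.mem_mk_right _ _)]
          exact ((hrT _ hadj (Sym2.mem_mk_right _ _)).2.2.2.2 u Sym2.eq_swap).symm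
        · rw [arc_neg (by simp [hu, hv])]
          exact D.isArc hadj
      arc_inter := by
        rintro e₁ e₂ h1 h2 - - hne p ⟨hp1, hp2⟩
        by_cases hpB : p ∈ B
        · obtain ⟨c1, s1⟩ := harcB e₁ h1 p hp1 hpB
          obtain ⟨c2, s2⟩ := harcB e₂ h2 p hp2 hpB
          have q1 := hrT e₁ h1 c1
          have q2 := hrT e₂ h2 c2
          rcases radii_inter hε q1.1 q2.1 s1 s2 with h | h
          · exact ⟨c, trivial, c1, c2, h⟩
          · exfalso
            have hm : r e₁ ∈ D.arc e₁ ∩ D.arc e₂ :=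
              ⟨q1.2.1 q1.2.2.1, h ▸ q2.2.1 q2.2.2.1⟩
            obtain ⟨w, -, w1, w2, hw⟩ := D.arc_inter h1 h2 (fun _ _ => trivial)
              (fun _ _ => trivial) hne hm
            have hwc : w = c := hg.1 w (by rw [← hw]; exact q1.1.le)
            rw [hw, hwc, _root_.dist_self] at q1
            exact hε.ne q1.1
        · have k1 := (harc e₁ h1 p hp1).resolve_right fun h => hpB (hsegB e₁ h1 h.1 h.2)
          have k2 := (harc e₂ h2 p hp2).resolve_right fun h => hpB (hsegB e₂ h2 h.1 h.2)
          exact D.arc_inter h1 h2 (fun _ _ => trivial) (fun _ _ => trivial) hne ⟨k1, k2⟩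
      pos_arc := by
        intro e he _ v _ hv
        rcases harc e he _ hv with h | ⟨hc, h⟩
        · exact D.pos_arc he (fun _ _ => trivial) v trivial h
        · rw [hg.1 v (hsegB e he hc h)]
          exact hc }
  obtain ⟨q, Q, hq, hQS, hqQ, hQB, hQ⟩ := hS.reroute hε hx hz
  refine ⟨D', _, rfl, ?_, hQ, ?_⟩
  · intro e he p hp
    exact (harc e he p hp).imp_right fun h => hsegB e he h.1 h.2
  · have hqB : q ∈ B := hq.le
    have hqK : q ∉ D.image := fun h => hz (by
      have : q = z := hSK ⟨hQS hqQ, h⟩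
      rwa [← this])
    rintro p ⟨hp, hpK⟩
    by_cases hpB : p ∈ B
    · left
      have hpq : p ∈ segment ℝ (D.pos c) q := by
        rcases hp with hp | hp
        · exact hp
        · have : p = q := hQB ⟨hp, hpB⟩
          rw [this]; exact right_mem_segment ℝ _ _
      rcases D'.mem_image.1 hpK with ⟨v, hv⟩ | ⟨e, he, hpe⟩
      · have hv' : D.pos v = p := hv
        have := hg.1 v (by rw [hv']; exact hpB)
        rw [← hv', this]
      · obtain ⟨hc, hs⟩ := harcB e he p hpe hpB
        have k := hrT e he hc
        rcases radii_inter hε hq k.1 hpq hs with h | h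
        · exact h
        · exact absurd (D.mem_image.2 (Or.inr ⟨e, he, h ▸ k.2.1 k.2.2.1⟩)) hqK
    · right
      have hpQ : p ∈ Q := hp.resolve_left fun h => hpB (radius_subset hε hq h)
      refine hSK ⟨hQS hpQ, ?_⟩
      rcases D'.mem_image.1 hpK with ⟨v, hv⟩ | ⟨e, he, hpe⟩
      · exact D.mem_image.2 (Or.inl ⟨v, hv⟩)
      · exact D.mem_image.2 (Or.inr ⟨e, he, (harc e he p hpe).resolve_right
          fun h => hpB (hsegB e he h.1 h.2)⟩)

/-- Add an edge along an arc meeting the drawing only in its endpoints. -/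
theorem isPlanar_addEdge (D : PlanarDrawingOn G Set.univ) {a b : V}
    (hnadj : ¬ G.Adj a b) {S : Set (ℝ × ℝ)} (hS : IsArc S (D.pos a) (D.pos b))
    (hSK : S ∩ D.image ⊆ {D.pos a, D.pos b}) : (addEdge G a b).IsPlanar := by
  classical
  have hedge : ∀ e ∈ (addEdge G a b).edgeSet, e ≠ s(a, b) → e ∈ G.edgeSet := by
    intro e he hne
    simp [addEdge] at he
    tauto
  have hne_of : ∀ e ∈ G.edgeSet, e ≠ s(a, b) := by
    rintro e he rfl; exact hnadj he
  let arc' : Sym2 V → Set (ℝ × ℝ) := fun e => if e = s(a, b) then S else D.arc e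
  have arc_pos : arc' s(a, b) = S := if_pos rfl
  have arc_neg : ∀ {e}, e ≠ s(a, b) → arc' e = D.arc e := fun h => if_neg h
  have key : ∀ e ∈ G.edgeSet, ∀ p ∈ S, p ∈ D.arc e →
      ∃ v, v ∈ e ∧ v ∈ s(a, b) ∧ p = D.pos v := by
    intro e he p hp hpe
    rcases hSK ⟨hp, D.mem_image.2 (Or.inr ⟨e, he, hpe⟩)⟩ with h | h
    · exact ⟨a, D.pos_arc he (fun _ _ => trivial) a trivial (h ▸ hpe), Sym2.mem_mk_left _ _, h⟩
    · have h : p = D.pos b := h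
      exact ⟨b, D.pos_arc he (fun _ _ => trivial) b trivial (h ▸ hpe), Sym2.mem_mk_right _ _, h⟩
  refine ⟨{ pos := D.pos, pos_inj := D.pos_inj, arc := arc', arc_spec := ?_, arc_inter := ?_,
            pos_arc := ?_ }⟩
  · intro u v _ _ hadj
    change IsArc (arc' s(u, v)) (D.pos u) (D.pos v)
    by_cases h : s(u, v) = s(a, b)
    · rw [h, arc_pos]
      rcases Sym2.eq_iff.1 h with ⟨rfl, rfl⟩ | ⟨rfl, rfl⟩
      · exact hS
      · exact hS.symm
    · rw [arc_neg h]
      exact D.isArc (hedge _ hadj h)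
  · rintro e₁ e₂ h1 h2 - - hne p ⟨hp1, hp2⟩
    by_cases k1 : e₁ = s(a, b)
    · have k2 : e₂ ≠ s(a, b) := fun h => hne (k1.trans h.symm)
      rw [arc_neg k2] at hp2
      rw [k1, arc_pos] at hp1
      obtain ⟨v, v1, v2, hv⟩ := key e₂ (hedge _ h2 k2) p hp1 hp2
      exact ⟨v, trivial, k1 ▸ v2, v1, hv⟩
    rw [arc_neg k1] at hp1
    by_cases k2 : e₂ = s(a, b)
    · rw [k2, arc_pos] at hp2
      obtain ⟨v, v1, v2, hv⟩ := key e₁ (hedge _ h1 k1) p hp2 hp1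
      exact ⟨v, trivial, v1, k2 ▸ v2, hv⟩
    · rw [arc_neg k2] at hp2
      exact D.arc_inter (hedge _ h1 k1) (hedge _ h2 k2) (fun _ _ => trivial)
        (fun _ _ => trivial) hne ⟨hp1, hp2⟩
  · intro e he _ v _ hv
    by_cases k : e = s(a, b)
    · rw [k, arc_pos] at hv
      rw [k]
      rcases hSK ⟨hv, D.mem_image.2 (Or.inl ⟨v, rfl⟩)⟩ with h | h
      · rw [D.pos_inj trivial trivial h]; exact Sym2.mem_mk_left _ _
      · rw [D.pos_inj trivial trivial (h : D.pos v = D.pos b)]; exact Sym2.mem_mk_right _ _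
    · rw [arc_neg k] at hv
      exact D.pos_arc (hedge _ he k) (fun _ _ => trivial) v trivial hv

/-- Restrict a drawing to a subgraph. -/
def restrict {H : SimpleGraph V} (D : PlanarDrawingOn H Set.univ) (hle : G ≤ H) :
    PlanarDrawingOn G Set.univ where
  pos := D.pos
  pos_inj := D.pos_inj
  arc := D.arc
  arc_spec := fun _ _ hu hv h => D.arc_spec hu hv (hle h)
  arc_inter := fun _ _ h1 h2 => D.arc_inter (SimpleGraph.edgeSet_mono hle h1)
    (SimpleGraph.edgeSet_mono hle h2)
  pos_arc := fun _ h => D.pos_arc (SimpleGraph.edgeSet_mono hle h)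

end PlanarDrawingOn

theorem onCommonFace_of_addEdge {V : Type*} (G : SimpleGraph V)
    (a b : V) (hab : a ≠ b) (hnadj : ¬ G.Adj a b) (h : (addEdge G a b).IsPlanar) :
    OnCommonFace G Set.univ {a, b} := by
  obtain ⟨D⟩ := h
  have hle : G ≤ addEdge G a b := le_sup_left
  have hadj : (addEdge G a b).Adj a b := by simp [addEdge, hab]
  let D' := D.restrict hle
  obtain ⟨f, fc, fi, f0, f1, hf⟩ := D.arc_spec trivial trivial hadj
  have hout : f '' Set.Ioo 0 1 ⊆ D'.imageᶜ := by
    rintro _ ⟨t, ht, rfl⟩ hK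
    have htI : t ∈ Set.Icc (0:ℝ) 1 := ⟨ht.1.le, ht.2.le⟩
    have hta : f t ∈ D.arc s(a, b) := hf ▸ ⟨t, htI, rfl⟩
    have hends : ∀ v ∈ s(a, b), f t ≠ D.pos v := by
      intro v hv h
      rcases Sym2.mem_iff.1 hv with rfl | rfl
      · exact ht.1.ne' (fi htI (by simp) (h.trans f0.symm))
      · exact ht.2.ne (fi htI (by simp) (h.trans f1.symm))
    rcases D'.mem_image.1 hK with ⟨v, hv⟩ | ⟨e, he, hpe⟩
    · have hv' : D.pos v = f t := hv
      exact hends v (D.pos_arc (e := s(a, b)) hadj (fun _ _ => trivial) v trivial (hv' ▸ hta)) hv'.symm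
    · have hne : e ≠ s(a, b) := by rintro rfl; exact hnadj he
      obtain ⟨v, -, -, hv, h⟩ := D.arc_inter (SimpleGraph.edgeSet_mono hle he)
        (show s(a, b) ∈ (addEdge G a b).edgeSet from hadj)
        (fun _ _ => trivial) (fun _ _ => trivial) hne ⟨hpe, hta⟩
      exact hends v hv h
  have hmid : f (1 / 2) ∈ f '' Set.Ioo 0 1 := ⟨1 / 2, by norm_num, rfl⟩
  have hpre : IsPreconnected (f '' Set.Ioo (0:ℝ) 1) :=
    isPreconnected_Ioo.image f (fc.mono Set.Ioo_subset_Icc_self)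
  have hsub := hpre.subset_connectedComponentIn hmid hout
  have hclo : closure (Set.Ioo (0:ℝ) 1) = Set.Icc 0 1 := closure_Ioo (by norm_num)
  have hcl := ContinuousOn.image_closure (f := f) (s := Set.Ioo 0 1) (by rwa [hclo])
  rw [hclo] at hcl
  refine ⟨D', _, ⟨f (1 / 2), hout hmid, rfl⟩, fun v hv => ⟨closure_mono hsub (hcl ?_), fun hi => ?_⟩⟩
  · rcases hv with rfl | hv
    · exact ⟨0, by simp, f0⟩
    · have hv : v = b := hv
      subst hv
      exact ⟨1, by simp, f1⟩
  · exact connectedComponentIn_subset _ _ (interior_subset hi) (D'.mem_image.2 (Or.inl ⟨v, rfl⟩))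

theorem addEdge_of_onCommonFace {V : Type*} [Finite V] (G : SimpleGraph V)
    (a b : V) (hab : a ≠ b) (hnadj : ¬ G.Adj a b) (h : OnCommonFace G Set.univ {a, b}) :
    (addEdge G a b).IsPlanar := by
  obtain ⟨D, F, ⟨x, hx, rfl⟩, hF⟩ := h
  set F := connectedComponentIn D.imageᶜ x with hFdef
  have hFo : IsOpen F := D.isCompact_image.isClosed.isOpen_compl.connectedComponentIn
  have hFc : IsPreconnected F := isPreconnected_connectedComponentIn
  have hFK : F ⊆ D.imageᶜ := connectedComponentIn_subset _ _
  obtain ⟨δa, ha, hga⟩ := D.exists_goodBall a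
  obtain ⟨δb, hb, hgb⟩ := D.exists_goodBall b
  have hd : 0 < Dist.dist (D.pos a) (D.pos b) :=
    dist_pos.2 fun h => hab (D.pos_inj trivial trivial h)
  obtain ⟨ε, hε, hεa, hεb, hεd⟩ : ∃ ε > 0, ε ≤ δa ∧ ε ≤ δb ∧ ε < Dist.dist (D.pos a) (D.pos b) / 2 := by
    refine ⟨min (min δa δb) (Dist.dist (D.pos a) (D.pos b) / 4), by positivity, ?_, ?_, ?_⟩
    · exact (min_le_left _ _).trans (min_le_left _ _)
    · exact (min_le_left _ _).trans (min_le_right _ _)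
    · exact (min_le_right _ _).trans_lt (by linarith)
  have hdisj : ∀ p ∈ Metric.closedBall (D.pos a) ε, p ∉ Metric.closedBall (D.pos b) ε := by
    intro p hp hp'
    have := _root_.dist_triangle_left (D.pos a) (D.pos b) p
    rw [Metric.mem_closedBall] at hp hp'
    linarith
  obtain ⟨xa, hxaF, hxa⟩ : ∃ p ∈ F, p ∈ Metric.closedBall (D.pos a) ε := by
    obtain ⟨p, hp, h⟩ := Metric.mem_closure_iff.1 (frontier_subset_closure (hF a (by simp))) ε hε
    exact ⟨p, hp, by rw [Metric.mem_closedBall, _root_.dist_comm]; exact h.le⟩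
  obtain ⟨xb, hxbF, hxb⟩ : ∃ p ∈ F, p ∈ Metric.closedBall (D.pos b) ε := by
    obtain ⟨p, hp, h⟩ := Metric.mem_closure_iff.1 (frontier_subset_closure (hF b (by simp))) ε hε
    exact ⟨p, hp, by rw [Metric.mem_closedBall, _root_.dist_comm]; exact h.le⟩
  have hne : xa ≠ xb := by rintro rfl; exact hdisj _ hxa hxb
  obtain ⟨S, hSF, hS⟩ := exists_arc_of_isOpen hFo hFc hxaF hxbF hne
  obtain ⟨D₁, S₁, hpos, harc, hS₁, hSK₁⟩ := D.star_step hε (hga ε hεa) hS hxa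
    (fun h => hdisj _ h hxb) (fun p hp => absurd hp.2 (hFK (hSF hp.1)))
  have hxbK : xb ∉ D₁.image := by
    intro h
    rcases D₁.mem_image.1 h with ⟨v, hv⟩ | ⟨e, he, hpe⟩
    · rw [hpos] at hv
      exact hFK hxbF (D.mem_image.2 (Or.inl ⟨v, hv⟩))
    · rcases harc e he _ hpe with h | h
      · exact hFK hxbF (D.mem_image.2 (Or.inr ⟨e, he, h⟩))
      · exact hdisj _ h hxb
  have hg₁ : D₁.GoodBall b ε := by
    refine ⟨?_, ?_⟩
    · rw [hpos]; exact (hgb ε hεb).1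
    · intro e he hbe p hp
      rw [hpos]
      rcases harc e he p hp with h | h
      · exact (hgb ε hεb).2 e he hbe p h
      · exact hdisj p h
  obtain ⟨D₂, S₂, hpos₂, -, hS₂, hSK₂⟩ := D₁.star_step hε hg₁ hS₁.symm
    (by rwa [hpos]) (by rw [hpos]; exact hdisj _ (Metric.mem_closedBall_self hε.le))
    (by
      rintro p hp
      rcases hSK₁ hp with h | h
      · exact h
      · have h : p = xb := h
        exact absurd (h ▸ hp.2) hxbK)
  rw [hpos] at hS₂ hSK₂ hpos₂
  refine D₂.isPlanar_addEdge hnadj (S := S₂) ?_ ?_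
  · rw [hpos₂]; exact hS₂.symm
  · rw [hpos₂, Set.pair_comm]; exact hSK₂

/-- For a 3-connected planar graph `G` and distinct non-adjacent
vertices `a, b`, the graph `G + {a,b}` is planar iff `a` and `b` lie on the boundary
of a common face in a planar embedding of `G`. -/
theorem stmt0 {V : Type*} [Fintype V] (G : SimpleGraph V)
    (h3 : KConnected 3 G) (hplanar : G.IsPlanar)
    (a b : V) (hab : a ≠ b) (hnadj : ¬ G.Adj a b) :
    (addEdge G a b).IsPlanar ↔ OnCommonFace G Set.univ {a, b} := by
  exact ⟨onCommonFace_of_addEdge G a b hab hnadj, addEdge_of_onCommonFace G a b hab hnadj⟩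
end

section
/- Let G be a planar graph, let a, b be vertices lying in a common biconnected component B_i of G but in no common triconnected component, let R_a, R_b be rigid components of T_3(B_i) with a ∈ V(R_a), b ∈ V(R_b), and let the path from R_a to R_b in T_3(B_i) be R_a, P_1, R_1, ..., R_k, P_{k+1}, R_b. Suppose G + {a,b} is planar, so that the components R_a, R_1, ..., R_k, R_b coalesce into a single rigid component R_{ab} of G + {a,b}, and let F_0, F_1 be the two faces of the planar embedding of R_{ab} whose boundaries contain the edge {a,b}. Then F_0 and F_1 define a partition of the set of separating-pair vertices ⋃_{i∈[k+1]} V(P_i) into two parts (according to which of the two face boundaries a vertex lies on), such that for every i ∈ [k+1] the two vertices of V(P_i) belong to different parts of the partition. -/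
open SimpleGraph

/-- There are three pairwise internally vertex-disjoint `s`–`t` paths
inside the vertex set `B`. -/
def ThreePathsOn {W : Type*} (G : SimpleGraph W) (B : Set W) (s t : W) : Prop :=
  ∃ p₁ p₂ p₃ : G.Walk s t,
    p₁.IsPath ∧ p₂.IsPath ∧ p₃.IsPath ∧
    (∀ x ∈ p₁.support, x ∈ B) ∧ (∀ x ∈ p₂.support, x ∈ B) ∧ (∀ x ∈ p₃.support, x ∈ B) ∧
    p₁ ≠ p₂ ∧ p₁ ≠ p₃ ∧ p₂ ≠ p₃ ∧
    IntDisjoint G p₁ p₂ ∧ IntDisjoint G p₁ p₃ ∧ IntDisjoint G p₂ p₃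

/-- `{s,t}` is a separating pair of (the subgraph induced on) `B`:
deleting both vertices disconnects it. -/
def SepPairOn {W : Type*} (G : SimpleGraph W) (B : Set W) (s t : W) : Prop :=
  s ∈ B ∧ t ∈ B ∧ s ≠ t ∧ (B \ {s, t}).Nonempty ∧ ¬ ConnectedOn G (B \ {s, t})

/-- `{s,t}` is a 3-connected separating pair of `B`: a separating pair whose two
vertices are joined by three internally vertex-disjoint paths. -/
def TriSepPairOn {W : Type*} (G : SimpleGraph W) (B : Set W) (s t : W) : Prop :=
  SepPairOn G B s t ∧ ThreePathsOn G B s t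

/-- Deleting the pair `{s,t}` separates `u` from `v` inside `B`. -/
def SeparatesOn {W : Type*} (G : SimpleGraph W) (B : Set W) (s t u v : W) : Prop :=
  u ∈ B \ {s, t} ∧ v ∈ B \ {s, t} ∧ ¬ ReachableWithin G (B \ {s, t}) u v

/-- `u` and `v` lie in a common triconnected component of `B`:
no 3-connected separating pair separates them. -/
def SameTriCompOn {W : Type*} (G : SimpleGraph W) (B : Set W) (u v : W) : Prop :=
  u ∈ B ∧ v ∈ B ∧ ∀ s t : W, TriSepPairOn G B s t → ¬ SeparatesOn G B s t u v

/-- `R` is (the vertex set of) a triconnected component of the block `B`. -/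
def IsTriCompOn {W : Type*} (G : SimpleGraph W) (B R : Set W) : Prop :=
  R ⊆ B ∧ R.Pairwise (SameTriCompOn G B) ∧
  ∀ R' : Set W, R ⊆ R' → R' ⊆ B → R'.Pairwise (SameTriCompOn G B) → R' = R

/-- The graph of the triconnected component on `R` of the block `B`: edges of `G`
inside `R` together with virtual edges for 3-connected separating pairs inside `R`. -/
def triCompGraph {W : Type*} (G : SimpleGraph W) (B R : Set W) : SimpleGraph W :=
  SimpleGraph.fromRel (fun u v => u ∈ R ∧ v ∈ R ∧ (G.Adj u v ∨ TriSepPairOn G B u v))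

/-- `R` is a rigid component (R-node): a triconnected component of `B` whose
component graph is 3-connected. -/
def IsRigidCompOn {W : Type*} (G : SimpleGraph W) (B R : Set W) : Prop :=
  IsTriCompOn G B R ∧ KConnectedOn 3 (triCompGraph G B R) R

/-- The restriction of the graph `H` to `R` is a cycle: connected, at least three
vertices, and every vertex has exactly two neighbours. -/
def IsCycleGraphOn {W : Type*} (H : SimpleGraph W) (R : Set W) : Prop :=
  ConnectedOn H R ∧ 3 ≤ R.ncard ∧ R.Finite ∧
  ∀ v ∈ R, ∃ x y : W, x ≠ y ∧ {z : W | H.Adj v z} = {x, y}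

/-- The path `R_a, P_1, R_1, …, R_k, P_(k+1), R_b` in the SPQR-tree `T_3(B)` of the
block `B`, between the rigid components `R 0 ∋ a` and `R (k+1) ∋ b`; `P i` is the
`i`-th 3-connected separating pair (P-node) on the path, adjacent to the rigid
components `R i` and `R (i+1)`. -/
structure SPQRPathOn {W : Type*} (G : SimpleGraph W) (B : Set W) (a b : W) (k : ℕ) where
  R : Fin (k + 2) → Set W
  P : Fin (k + 1) → W × W
  rigid : ∀ i, IsRigidCompOn G B (R i)
  sep : ∀ i, TriSepPairOn G B (P i).1 (P i).2
  ha : a ∈ R 0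
  hb : b ∈ R (Fin.last (k + 1))
  linkL : ∀ i : Fin (k + 1), (P i).1 ∈ R i.castSucc ∧ (P i).2 ∈ R i.castSucc
  linkR : ∀ i : Fin (k + 1), (P i).1 ∈ R i.succ ∧ (P i).2 ∈ R i.succ
  R_inj : Function.Injective R
  P_inj : Function.Injective P

/-! ### Plane topology: Janiszewski's theorem via continuous logarithms -/

/-- `p` and `q` are not separated by `K`. -/
def NotSep {X : Type*} [TopologicalSpace X] (K : Set X) (p q : X) : Prop :=
  ∃ T : Set X, IsPreconnected T ∧ T ⊆ Kᶜ ∧ p ∈ T ∧ q ∈ T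

/-- `f` has a continuous logarithm on `K`. -/
def HasLog (K : Set ℂ) (f : ℂ → ℂ) : Prop :=
  ∃ g : ℂ → ℂ, ContinuousOn g K ∧ ∀ z ∈ K, f z = Complex.exp (g z)

theorem NotSep.mono {X : Type*} [TopologicalSpace X] {K L : Set X} {p q : X}
    (h : NotSep K p q) (hL : L ⊆ K) : NotSep L p q := by
  obtain ⟨T, h1, h2, h3⟩ := h
  exact ⟨T, h1, fun x hx hxL => h2 hx (hL hxL), h3⟩

theorem NotSep.notMem {X : Type*} [TopologicalSpace X] {K : Set X} {p q : X}
    (h : NotSep K p q) : p ∉ K ∧ q ∉ K := by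
  obtain ⟨T, h1, h2, h3, h4⟩ := h
  exact ⟨h2 h3, h2 h4⟩

theorem exists_global_log {X : Type*} [TopologicalSpace X] [SimplyConnectedSpace X]
    [LocallyPathConnectedSpace X] (f : X → ℂ) (hf : Continuous f) (h0 : ∀ x, f x ≠ 0) :
    ∃ g : X → ℂ, Continuous g ∧ ∀ x, f x = Complex.exp (g x) := by
  obtain ⟨x₀⟩ : Nonempty X := inferInstance
  rcases Complex.isCoveringMapOn_exp.existsUnique_continuousMap_lifts
    ⟨f, hf⟩ (Complex.exp_log (h0 x₀)) (fun x ↦ h0 x) with ⟨g, ⟨-, hg⟩, -⟩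
  exact ⟨g, g.continuous, fun x => (congrFun hg x).symm⟩

theorem eq_of_exp_const {X : Type*} [TopologicalSpace X] {S : Set X} (hS : IsPreconnected S)
    (f : X → ℂ) (hf : ContinuousOn f S) (c : ℂ) (hc : ∀ x ∈ S, Complex.exp (f x) = c)
    {x y : X} (hx : x ∈ S) (hy : y ∈ S) : f x = f y := by
  refine hS.induction₂ (fun x y => f x = f y) ?_ ?_ ?_ hx hy
  · intro x hx
    have h1 : ∀ᶠ y in nhdsWithin x S, dist (f y) (f x) < 1 :=
      (hf x hx).eventually (Metric.ball_mem_nhds _ one_pos)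
    filter_upwards [h1, self_mem_nhdsWithin] with y h1 hy
    obtain ⟨n, hn⟩ := Complex.exp_eq_exp_iff_exists_int.1 ((hc y hy).trans (hc x hx).symm)
    rw [hn, dist_eq_norm] at h1
    have h2 : ‖(n : ℂ) * (2 * Real.pi * Complex.I)‖ = |(n : ℝ)| * (2 * Real.pi) := by
      simp [abs_of_pos Real.pi_pos]
    rw [add_sub_cancel_left, h2] at h1
    have h3 : |(n : ℝ)| < 1 := by
      nlinarith [Real.pi_gt_three, abs_nonneg (n : ℝ)]
    have h4 : n = 0 := by
      rw [← Int.abs_lt_one_iff]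
      exact_mod_cast h3
    rw [hn, h4]; simp
  · intro x y z _ _ _ h h'; exact h.trans h'
  · intro x y _ _ h; exact h.symm

theorem hasLog_of_notSep {K : Set ℂ} (hK : IsClosed K) {p q : ℂ} (h : NotSep K p q) :
    HasLog K (fun z => (z - p) / (z - q)) := by
  obtain ⟨T, hT, hTK, hp, hq⟩ := h
  have hne : ∀ x ∈ T, ∀ z ∈ K, z - x ≠ 0 := by
    intro x hx z hz h
    rw [sub_eq_zero] at h
    subst h
    exact hTK hx hz
  have symm : ∀ x y, x ∈ T → y ∈ T → HasLog K (fun z => (z - x) / (z - y)) →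
      HasLog K (fun z => (z - y) / (z - x)) := by
    rintro x y hx hy ⟨g, hg, h⟩
    refine ⟨fun z => - g z, hg.neg, fun z hz => ?_⟩
    rw [Complex.exp_neg, ← h z hz, inv_div]
  refine hT.induction₂ (fun x y => HasLog K (fun z => (z - x) / (z - y))) ?_ ?_ symm hp hq
  · intro x hx
    have hxK : Kᶜ ∈ nhds x := hK.isOpen_compl.mem_nhds (hTK hx)
    obtain ⟨δ, hδ, hball⟩ := Metric.mem_nhds_iff.1 hxK
    have h1 : ∀ᶠ y in nhdsWithin x T, y ∈ Metric.ball x δ :=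
      mem_nhdsWithin_of_mem_nhds (Metric.ball_mem_nhds _ hδ)
    filter_upwards [h1, self_mem_nhdsWithin] with y h1 hy
    apply symm y x hy hx
    have hslit : ∀ z ∈ K, (z - y) / (z - x) ∈ Complex.slitPlane := by
      intro z hz
      have h0 := hne x hx z hz
      have e : (z - y) / (z - x) = 1 + (x - y) / (z - x) := by
        field_simp; ring
      rw [e]
      apply Complex.mem_slitPlane_of_norm_lt_one
      have hzδ : δ ≤ ‖z - x‖ := by
        by_contra hlt
        rw [not_le, ← dist_eq_norm] at hlt
        exact hball hlt hz
      rw [norm_div, div_lt_one (norm_pos_iff.2 h0), ← dist_eq_norm, _root_.dist_comm]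
      exact lt_of_lt_of_le h1 hzδ
    refine ⟨fun z => Complex.log ((z - y) / (z - x)), ?_, ?_⟩
    · apply ContinuousOn.clog _ hslit
      exact ContinuousOn.div (by fun_prop) (by fun_prop) (fun z hz => hne x hx z hz)
    · intro z hz
      rw [Complex.exp_log]
      exact Complex.slitPlane_ne_zero (hslit z hz)
  · rintro x y z hx hy hz ⟨g, hg, h⟩ ⟨g', hg', h'⟩
    refine ⟨fun z => g z + g' z, hg.add hg', fun w hw => ?_⟩
    rw [Complex.exp_add, ← h w hw, ← h' w hw]
    have := hne y hy w hw
    have := hne z hz w hw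
    field_simp

theorem isPreconnected_norm_gt (R : ℝ) (hR : 0 ≤ R) : IsPreconnected {z : ℂ | R < ‖z‖} := by
  have h : {z : ℂ | R < ‖z‖} =
      (fun t : ℝ × ℝ => (t.1 : ℂ) * Complex.exp (t.2 * Complex.I)) '' (Set.Ioi R ×ˢ Set.univ) := by
    ext z
    constructor
    · intro hz
      exact ⟨(‖z‖, z.arg), ⟨hz, trivial⟩, Complex.norm_mul_exp_arg_mul_I z⟩
    · rintro ⟨⟨r, θ⟩, ⟨hr, -⟩, rfl⟩
      have hr' : R < r := hr
      simp [Complex.norm_exp_ofReal_mul_I, abs_of_pos (hR.trans_lt hr')]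
      exact hr'
  rw [h]
  exact (isPreconnected_Ioi.prod isPreconnected_univ).image _ (by fun_prop)

theorem notMem_of_hasLog_bounded {K : Set ℂ} (hK : IsClosed K) {p q : ℂ}
    (hp : p ∉ K) (hq : q ∉ K) (h : HasLog K (fun z => (z - p) / (z - q)))
    (hb : Bornology.IsBounded (connectedComponentIn Kᶜ p)) :
    q ∈ connectedComponentIn Kᶜ p := by
  classical
  by_contra hqU
  set U := connectedComponentIn Kᶜ p with hU
  have hUo : IsOpen U := hK.isOpen_compl.connectedComponentIn
  have hpU : p ∈ U := mem_connectedComponentIn hp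
  have hfr : frontier U ⊆ K := by
    intro z hz
    by_contra hzK
    have hzU : z ∈ connectedComponentIn Kᶜ z := mem_connectedComponentIn hzK
    have hzo : IsOpen (connectedComponentIn Kᶜ z) := hK.isOpen_compl.connectedComponentIn
    rw [hUo.frontier_eq] at hz
    obtain ⟨w, hw1, hw2⟩ := mem_closure_iff.1 hz.1 _ hzo hzU
    have e1 := connectedComponentIn_eq hw1
    have e2 := connectedComponentIn_eq hw2
    exact hz.2 (by rw [hU, e2, ← e1]; exact hzU)
  obtain ⟨g, hg, hgl⟩ := h
  obtain ⟨G, hG⟩ := ContinuousMap.exists_restrict_eq hK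
    (⟨K.domRestrict g, continuousOn_iff_continuous_domRestrict.mp hg⟩ : C(K, ℂ))
  have hGK : ∀ z ∈ K, G z = g z := fun z hz => congrArg (fun f => f ⟨z, hz⟩) hG
  let F : ℂ → ℂ := fun z => if z ∈ U then (z - q) * Complex.exp (G z) else z - p
  have hF : Continuous F := by
    refine Continuous.if ?_ (by fun_prop) (by fun_prop)
    intro z hz
    have hzK : z ∈ K := hfr hz
    rw [hGK z hzK, ← hgl z hzK]
    have : z - q ≠ 0 := by
      intro h
      rw [sub_eq_zero] at h
      exact hq (h ▸ hzK)
    field_simp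
  have hF0 : ∀ z, F z ≠ 0 := by
    intro z
    simp only [F]
    split_ifs with hz
    · refine mul_ne_zero ?_ (Complex.exp_ne_zero _)
      intro h
      rw [sub_eq_zero] at h
      exact hqU (h ▸ hz)
    · intro h
      rw [sub_eq_zero] at h
      exact hz (h ▸ hpU)
  obtain ⟨L, hL, hLF⟩ := exists_global_log F hF hF0
  obtain ⟨R, hR⟩ := hb.subset_ball p
  have hRpos : 0 < R := by
    have := hR hpU
    simpa using this
  let φ : ℝ → ℂ := fun θ => L (p + R * Complex.exp (θ * Complex.I)) - θ * Complex.I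
  have hφ : Continuous φ := by fun_prop
  have hφc : ∀ θ ∈ (Set.univ : Set ℝ), Complex.exp (φ θ) = R := by
    intro θ _
    have hn : p + R * Complex.exp (θ * Complex.I) ∉ U := by
      intro h
      have := hR h
      simp [Complex.norm_exp_ofReal_mul_I, abs_of_pos hRpos] at this
    simp only [φ]
    rw [Complex.exp_sub, ← hLF]
    simp only [F, if_neg hn]
    have := Complex.exp_ne_zero (θ * Complex.I)
    field_simp
    ring
  have := eq_of_exp_const isPreconnected_univ φ hφ.continuousOn R hφc
    (Set.mem_univ 0) (Set.mem_univ (2 * Real.pi))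
  simp only [φ] at this
  have h2 : Complex.exp (((2 * Real.pi : ℝ) : ℂ) * Complex.I) = 1 := by
    push_cast
    exact Complex.exp_two_pi_mul_I
  rw [h2] at this
  simp only [Complex.ofReal_zero, zero_mul, Complex.exp_zero, sub_zero] at this
  have h3 : ((2 * Real.pi : ℝ) : ℂ) * Complex.I = 0 := by linear_combination this
  simp [Real.pi_ne_zero] at h3

theorem HasLog.symm {K : Set ℂ} {p q : ℂ} (h : HasLog K (fun z => (z - p) / (z - q))) :
    HasLog K (fun z => (z - q) / (z - p)) := by
  obtain ⟨g, hg, h⟩ := h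
  refine ⟨fun z => - g z, hg.neg, fun z hz => ?_⟩
  rw [Complex.exp_neg, ← h z hz, inv_div]

theorem notSep_of_hasLog {K : Set ℂ} (hK : IsCompact K) {p q : ℂ}
    (hp : p ∉ K) (hq : q ∉ K) (h : HasLog K (fun z => (z - p) / (z - q))) : NotSep K p q := by
  by_cases hbp : Bornology.IsBounded (connectedComponentIn Kᶜ p)
  · exact ⟨_, isPreconnected_connectedComponentIn, connectedComponentIn_subset _ _,
      mem_connectedComponentIn hp, notMem_of_hasLog_bounded hK.isClosed hp hq h hbp⟩
  by_cases hbq : Bornology.IsBounded (connectedComponentIn Kᶜ q)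
  · exact ⟨_, isPreconnected_connectedComponentIn, connectedComponentIn_subset _ _,
      notMem_of_hasLog_bounded hK.isClosed hq hp h.symm hbq, mem_connectedComponentIn hq⟩
  obtain ⟨R, hR⟩ := hK.isBounded.subset_closedBall 0
  set S := {z : ℂ | max R 0 < ‖z‖} with hS
  have hSK : S ⊆ Kᶜ := by
    intro z hz hzK
    have h1 := hR hzK
    simp only [hS, Set.mem_ofPred_eq] at hz
    rw [mem_closedBall_zero_iff] at h1
    exact absurd (lt_of_le_of_lt (le_max_left R 0) hz) (not_lt.2 h1)
  have key : ∀ x, ¬ Bornology.IsBounded (connectedComponentIn Kᶜ x) →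
      ∃ w ∈ S, w ∈ connectedComponentIn Kᶜ x := by
    intro x hx
    by_contra! hcon
    apply hx
    refine (Metric.isBounded_closedBall (x := (0 : ℂ)) (r := max R 0)).subset ?_
    intro w hw
    by_contra hw'
    rw [mem_closedBall_zero_iff, not_le] at hw'
    exact hcon w hw' hw
  obtain ⟨w, hw, hwp⟩ := key p hbp
  obtain ⟨w', hw', hwq⟩ := key q hbq
  have hSc : IsPreconnected S := isPreconnected_norm_gt _ (le_max_right _ _)
  have h1 := hSc.subset_connectedComponentIn hw hSK
  have e1 := connectedComponentIn_eq hwp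
  have e2 := connectedComponentIn_eq hwq
  have e3 := connectedComponentIn_eq (h1 hw')
  refine ⟨_, isPreconnected_connectedComponentIn, connectedComponentIn_subset _ _,
      mem_connectedComponentIn hp, ?_⟩
  rw [e1, e3, ← e2]
  exact mem_connectedComponentIn hq

theorem janiszewski_complex {X Y : Set ℂ} (hX : IsCompact X) (hY : IsCompact Y)
    (hXY : IsPreconnected (X ∩ Y)) {p q : ℂ} (h1 : NotSep X p q) (h2 : NotSep Y p q) :
    NotSep (X ∪ Y) p q := by
  classical
  have hp : p ∉ X ∪ Y := fun h => h.elim h1.notMem.1 h2.notMem.1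
  have hq : q ∉ X ∪ Y := fun h => h.elim h1.notMem.2 h2.notMem.2
  apply notSep_of_hasLog (hX.union hY) hp hq
  obtain ⟨f, hf, hfl⟩ := hasLog_of_notSep hX.isClosed h1
  obtain ⟨g, hg, hgl⟩ := hasLog_of_notSep hY.isClosed h2
  obtain ⟨c, hc1, hc⟩ : ∃ c : ℂ, Complex.exp c = 1 ∧ ∀ z ∈ X ∩ Y, f z = g z + c := by
    rcases (X ∩ Y).eq_empty_or_nonempty with he | ⟨w, hw⟩
    · exact ⟨0, by simp, by simp [he]⟩
    have hh : ∀ z ∈ X ∩ Y, Complex.exp (f z - g z) = 1 := by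
      intro z hz
      rw [Complex.exp_sub, ← hfl z hz.1, ← hgl z hz.2, hgl z hz.2]
      exact div_self (Complex.exp_ne_zero _)
    refine ⟨f w - g w, hh w hw, fun z hz => ?_⟩
    have := eq_of_exp_const hXY (fun z => f z - g z)
      ((hf.mono Set.inter_subset_left).sub (hg.mono Set.inter_subset_right)) 1 hh hz hw
    rw [← this]; ring
  let F : ℂ → ℂ := fun z => if z ∈ X then f z else g z + c
  have eX : Set.EqOn F f X := fun z hz => if_pos hz
  have eY : Set.EqOn F (fun z => g z + c) Y := by
    intro z hz
    by_cases hzX : z ∈ X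
    · simp only [F, if_pos hzX]; exact hc z ⟨hzX, hz⟩
    · simp only [F, if_neg hzX]
  refine ⟨F, ?_, ?_⟩
  · exact ContinuousOn.union_of_isClosed (hf.congr eX) ((hg.add continuousOn_const).congr eY)
      hX.isClosed hY.isClosed
  · rintro z (hz | hz)
    · rw [eX hz]; exact hfl z hz
    · rw [eY hz, Complex.exp_add, hc1, mul_one]; exact hgl z hz

theorem arc_notSep_complex {f : ℝ → ℂ} {s t : ℝ} (hst : s ≤ t)
    (hf : ContinuousOn f (Set.Icc s t)) (hi : Set.InjOn f (Set.Icc s t)) {p q : ℂ}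
    (hp : p ∉ f '' Set.Icc s t) (hq : q ∉ f '' Set.Icc s t) : NotSep (f '' Set.Icc s t) p q := by
  apply notSep_of_hasLog (isCompact_Icc.image_of_continuousOn hf) hp hq
  let e : Set.Icc s t → ℂ := fun x => f x
  have hec : Continuous e := continuousOn_iff_continuous_domRestrict.mp hf
  have hei : Function.Injective e := fun x y h => Subtype.ext (hi x.2 y.2 h)
  have hemb : Topology.IsClosedEmbedding e := hec.isClosedEmbedding hei
  let φ : ℝ → ℂ := fun x => (e (Set.projIcc s t hst x) - p) / (e (Set.projIcc s t hst x) - q)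
  have hnp : ∀ x, e x - p ≠ 0 := by
    intro x h
    rw [sub_eq_zero] at h
    exact hp ⟨x, x.2, h⟩
  have hnq : ∀ x, e x - q ≠ 0 := by
    intro x h
    rw [sub_eq_zero] at h
    exact hq ⟨x, x.2, h⟩
  have hpr : Continuous (fun x => e (Set.projIcc s t hst x)) := hec.comp continuous_projIcc
  obtain ⟨L, hL, hLφ⟩ := exists_global_log φ
    ((hpr.sub continuous_const).div (hpr.sub continuous_const) (fun x => hnq _))
    (fun x => div_ne_zero (hnp _) (hnq _))
  obtain ⟨g, hg⟩ := ContinuousMap.exists_extension hemb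
    (⟨fun x => L x, hL.comp continuous_subtype_val⟩ : C(Set.Icc s t, ℂ))
  refine ⟨g, g.continuous.continuousOn, ?_⟩
  rintro _ ⟨x, hx, rfl⟩
  have h1 : g (f x) = L x := congrArg (fun f => f ⟨x, hx⟩) hg
  rw [h1, ← hLφ]
  simp only [φ, Set.projIcc_of_mem hst hx, e]

theorem NotSep.image {X Y : Type*} [TopologicalSpace X] [TopologicalSpace Y] (e : X ≃ₜ Y)
    {K : Set X} {p q : X} (h : NotSep K p q) : NotSep (e '' K) (e p) (e q) := by
  obtain ⟨T, h1, h2, h3, h4⟩ := h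
  refine ⟨e '' T, h1.image _ e.continuous.continuousOn, ?_, ⟨p, h3, rfl⟩, ⟨q, h4, rfl⟩⟩
  rintro _ ⟨x, hx, rfl⟩ ⟨y, hy, hxy⟩
  rw [e.injective hxy] at hy
  exact h2 hx hy

theorem NotSep.of_image {X Y : Type*} [TopologicalSpace X] [TopologicalSpace Y] (e : X ≃ₜ Y)
    {K : Set X} {p q : X} (h : NotSep (e '' K) (e p) (e q)) : NotSep K p q := by
  have := h.image e.symm
  simpa [Set.image_image] using this

theorem janiszewski {X Y : Set (ℝ × ℝ)} (hX : IsCompact X) (hY : IsCompact Y)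
    (hXY : IsPreconnected (X ∩ Y)) {p q : ℝ × ℝ} (h1 : NotSep X p q) (h2 : NotSep Y p q) :
    NotSep (X ∪ Y) p q := by
  let e : ℝ × ℝ ≃ₜ ℂ := Complex.equivRealProdCLM.symm.toHomeomorph
  apply NotSep.of_image e
  rw [Set.image_union]
  refine janiszewski_complex (hX.image e.continuous) (hY.image e.continuous) ?_
    (h1.image e) (h2.image e)
  rw [← Set.image_inter e.injective]
  exact hXY.image _ e.continuous.continuousOn

theorem arc_notSep {f : ℝ → ℝ × ℝ} {s t : ℝ} (hst : s ≤ t)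
    (hf : ContinuousOn f (Set.Icc s t)) (hi : Set.InjOn f (Set.Icc s t)) {p q : ℝ × ℝ}
    (hp : p ∉ f '' Set.Icc s t) (hq : q ∉ f '' Set.Icc s t) : NotSep (f '' Set.Icc s t) p q := by
  let e : ℝ × ℝ ≃ₜ ℂ := Complex.equivRealProdCLM.symm.toHomeomorph
  apply NotSep.of_image e
  rw [Set.image_image]
  refine arc_notSep_complex hst (e.continuous.comp_continuousOn hf)
    (fun x hx y hy h => hi hx hy (e.injective h)) ?_ ?_
  · rintro ⟨x, hx, h⟩; exact hp ⟨x, hx, e.injective h⟩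
  · rintro ⟨x, hx, h⟩; exact hq ⟨x, hx, e.injective h⟩

/-! ### Facts about planar drawings -/

namespace PlanarDrawingOn

variable {W : Type*} {G : SimpleGraph W} {A : Set W}

/-- Edges of `G` inside `A`. -/
def edgesIn (G : SimpleGraph W) (A : Set W) : Set (Sym2 W) :=
  {e : Sym2 W | e ∈ G.edgeSet ∧ ∀ x ∈ e, x ∈ A}

/-- The part of the drawing given by some vertices and some edges. -/
def part (D : PlanarDrawingOn G A) (S : Set W) (T : Set (Sym2 W)) : Set (ℝ × ℝ) :=
  D.pos '' S ∪ ⋃ e ∈ T, D.arc e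

theorem arc_param (D : PlanarDrawingOn G A) {e : Sym2 W} (he : e ∈ edgesIn G A) :
    ∃ f : ℝ → ℝ × ℝ, ContinuousOn f (Set.Icc 0 1) ∧ f '' Set.Icc 0 1 = D.arc e := by
  induction e with
  | h u v =>
    obtain ⟨f, h1, -, -, -, h2⟩ := D.arc_spec (he.2 u (by simp)) (he.2 v (by simp)) he.1
    exact ⟨f, h1, h2⟩

theorem arc_compact (D : PlanarDrawingOn G A) {e : Sym2 W} (he : e ∈ edgesIn G A) :
    IsCompact (D.arc e) := by
  obtain ⟨f, h1, h2⟩ := D.arc_param he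
  rw [← h2]
  exact isCompact_Icc.image_of_continuousOn h1

theorem arc_preconnected (D : PlanarDrawingOn G A) {e : Sym2 W} (he : e ∈ edgesIn G A) :
    IsPreconnected (D.arc e) := by
  obtain ⟨f, h1, h2⟩ := D.arc_param he
  rw [← h2]
  exact isPreconnected_Icc.image _ h1

theorem pos_mem_arc (D : PlanarDrawingOn G A) {e : Sym2 W} (he : e ∈ edgesIn G A) {v : W}
    (hv : v ∈ e) : D.pos v ∈ D.arc e := by
  obtain ⟨w, rfl⟩ := hv
  obtain ⟨f, -, -, h0, -, h2⟩ := D.arc_spec (he.2 v (by simp)) (he.2 w (by simp)) he.1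
  rw [← h2, ← h0]
  exact ⟨0, by simp, rfl⟩

theorem part_compact [Finite W] (D : PlanarDrawingOn G A) (S : Set W) {T : Set (Sym2 W)}
    (hT : T ⊆ edgesIn G A) : IsCompact (D.part S T) := by
  have : Finite (Sym2 W) := Quot.finite _
  refine (Set.toFinite _).isCompact.union ?_
  exact (Set.toFinite T).isCompact_biUnion (fun e he => D.arc_compact (hT he))

theorem part_inter (D : PlanarDrawingOn G A) {S S' : Set W} {T T' : Set (Sym2 W)}
    (hS : S ⊆ A) (hS' : S' ⊆ A) (hT : T ⊆ edgesIn G A) (hT' : T' ⊆ edgesIn G A)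
    (hd : Disjoint T T') {z : ℝ × ℝ} (hz : z ∈ D.part S T) (hz' : z ∈ D.part S' T') :
    ∃ v ∈ A, z = D.pos v ∧ (v ∈ S ∨ ∃ e ∈ T, v ∈ e) ∧ (v ∈ S' ∨ ∃ e ∈ T', v ∈ e) := by
  simp only [part, Set.mem_union, Set.mem_image, Set.mem_iUnion, exists_prop] at hz hz'
  rcases hz with ⟨v, hv, rfl⟩ | ⟨e, he, hz⟩
  · rcases hz' with ⟨w, hw, h⟩ | ⟨e', he', hz'⟩
    · have := D.pos_inj (hS' hw) (hS hv) h
      subst this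
      exact ⟨w, hS hv, rfl, Or.inl hv, Or.inl hw⟩
    · exact ⟨v, hS hv, rfl, Or.inl hv,
        Or.inr ⟨e', he', D.pos_arc (hT' he').1 (hT' he').2 v (hS hv) hz'⟩⟩
  · rcases hz' with ⟨w, hw, rfl⟩ | ⟨e', he', hz'⟩
    · exact ⟨w, hS' hw, rfl, Or.inr ⟨e, he, D.pos_arc (hT he).1 (hT he).2 w (hS' hw) hz⟩,
        Or.inl hw⟩
    · have hne : e ≠ e' := fun h => Set.disjoint_left.1 hd he (h ▸ he')
      obtain ⟨v, hvA, h1, h2, h3⟩ := D.arc_inter (hT he).1 (hT' he').1 (hT he).2 (hT' he').2 hne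
        ⟨hz, hz'⟩
      exact ⟨v, hvA, h3, Or.inr ⟨e, he, h1⟩, Or.inr ⟨e', he', h2⟩⟩

theorem image_eq_part (D : PlanarDrawingOn G A) : D.image = D.part A (edgesIn G A) := rfl

theorem image_compact [Finite W] (D : PlanarDrawingOn G A) : IsCompact D.image :=
  D.part_compact A subset_rfl

theorem face_open [Finite W] (D : PlanarDrawingOn G A) {F : Set (ℝ × ℝ)} (hF : D.IsFace F) :
    IsOpen F := by
  obtain ⟨x, -, rfl⟩ := hF
  exact D.image_compact.isClosed.isOpen_compl.connectedComponentIn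

theorem face_preconnected (D : PlanarDrawingOn G A) {F : Set (ℝ × ℝ)} (hF : D.IsFace F) :
    IsPreconnected F := by
  obtain ⟨x, -, rfl⟩ := hF
  exact isPreconnected_connectedComponentIn

theorem face_subset (D : PlanarDrawingOn G A) {F : Set (ℝ × ℝ)} (hF : D.IsFace F) :
    F ⊆ D.imageᶜ := by
  obtain ⟨x, -, rfl⟩ := hF
  exact connectedComponentIn_subset _ _

theorem face_eq_of_notSep (D : PlanarDrawingOn G A) {F F' : Set (ℝ × ℝ)} (hF : D.IsFace F)
    (hF' : D.IsFace F') {p q : ℝ × ℝ} (hp : p ∈ F) (hq : q ∈ F') (h : NotSep D.image p q) :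
    F = F' := by
  obtain ⟨x, hx, rfl⟩ := hF
  obtain ⟨y, hy, rfl⟩ := hF'
  obtain ⟨T, h1, h2, h3, h4⟩ := h
  rw [connectedComponentIn_eq hp, connectedComponentIn_eq hq]
  exact connectedComponentIn_eq (h1.subset_connectedComponentIn h3 h2 h4)

theorem frontier_face_subset [Finite W] (D : PlanarDrawingOn G A) {F : Set (ℝ × ℝ)}
    (hF : D.IsFace F) : frontier F ⊆ D.image := by
  intro z hz
  by_contra hzK
  have hz' : D.IsFace (connectedComponentIn D.imageᶜ z) := ⟨z, hzK, rfl⟩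
  have hzo := D.face_open hz'
  have hzU : z ∈ connectedComponentIn D.imageᶜ z := mem_connectedComponentIn hzK
  rw [(D.face_open hF).frontier_eq] at hz
  obtain ⟨w, hw1, hw2⟩ := mem_closure_iff.1 hz.1 _ hzo hzU
  have := D.face_eq_of_notSep hF hz' hw2 hw1
    ⟨_, D.face_preconnected hF, D.face_subset hF, hw2, hw2⟩
  rw [this] at hz
  exact hz.2 hzU

theorem walk_image (D : PlanarDrawingOn G A) {u v : W} (w : G.Walk u v)
    (hw : ∀ x ∈ w.support, x ∈ A) :
    ∃ Z : Set (ℝ × ℝ), IsPreconnected Z ∧ IsCompact Z ∧ D.pos u ∈ Z ∧ D.pos v ∈ Z ∧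
      Z ⊆ D.part {x | x ∈ w.support} {e | e ∈ w.edges} := by
  induction w with
  | nil =>
    refine ⟨{D.pos _}, isPreconnected_singleton, isCompact_singleton, rfl, rfl, ?_⟩
    rintro z rfl
    exact Or.inl ⟨_, by simp, rfl⟩
  | @cons u u' v h w ih =>
    obtain ⟨Z, h1, h2, h3, h4, h5⟩ := ih (fun x hx => hw x (by simp [hx]))
    have he : s(u, u') ∈ edgesIn G A := by
      refine ⟨h, fun x hx => ?_⟩
      rcases Sym2.mem_iff.1 hx with rfl | rfl
      · exact hw _ (by simp)
      · exact hw _ (by simp)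
    refine ⟨D.arc s(u, u') ∪ Z, ?_, (D.arc_compact he).union h2,
      Or.inl (D.pos_mem_arc he (by simp)), Or.inr h4, ?_⟩
    · exact (D.arc_preconnected he).union (D.pos u') (D.pos_mem_arc he (by simp)) h3 h1
    · rintro z (hz | hz)
      · exact Or.inr (Set.mem_biUnion (x := s(u, u')) (by simp) hz)
      · rcases h5 hz with ⟨x, hx, rfl⟩ | hz
        · exact Or.inl ⟨x, by simp only [Set.mem_ofPred_eq] at hx ⊢; simp [hx], rfl⟩
        · simp only [Set.mem_iUnion, exists_prop] at hz
          obtain ⟨e, he, hz⟩ := hz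
          refine Or.inr (Set.mem_biUnion (x := e) ?_ hz)
          simp only [Set.mem_ofPred_eq] at he ⊢
          simp [he]

/-- Points of the two faces close to the middle of the edge `ab`. -/
theorem exists_near {F0 F1 Y : Set (ℝ × ℝ)} {m : ℝ × ℝ} (hY : IsClosed Y) (hm : m ∉ Y)
    (h0 : m ∈ frontier F0) (h1 : m ∈ frontier F1) :
    ∃ p ∈ F0, ∃ q ∈ F1, NotSep Y p q := by
  obtain ⟨δ, hδ, hball⟩ := Metric.mem_nhds_iff.1 (hY.isOpen_compl.mem_nhds hm)
  obtain ⟨p, hp, hpF⟩ := mem_closure_iff.1 (frontier_subset_closure h0) _ Metric.isOpen_ball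
    (Metric.mem_ball_self hδ)
  obtain ⟨q, hq, hqF⟩ := mem_closure_iff.1 (frontier_subset_closure h1) _ Metric.isOpen_ball
    (Metric.mem_ball_self hδ)
  exact ⟨p, hpF, q, hqF, _, (convex_ball m δ).isPreconnected, hball, hp, hq⟩

/-- No vertex off the edge `ab` lies on both faces at `ab`, provided it is avoided by some cycle
through `ab`. -/
theorem not_both [Finite W] (D : PlanarDrawingOn G A) {a b x : W} (ha : a ∈ A) (hb : b ∈ A)
    (hab : G.Adj a b) {F0 F1 : Set (ℝ × ℝ)} (hF0 : D.IsFace F0) (hF1 : D.IsFace F1)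
    (hne : F0 ≠ F1) (hedge0 : D.arc s(a, b) ⊆ frontier F0) (hedge1 : D.arc s(a, b) ⊆ frontier F1)
    (hx : x ∈ A) (hxa : x ≠ a) (hxb : x ≠ b) (w : G.Walk a b) (hw : ∀ y ∈ w.support, y ∈ A)
    (hxw : x ∉ w.support) (hew : s(a, b) ∉ w.edges)
    (h0 : D.pos x ∈ frontier F0) (h1 : D.pos x ∈ frontier F1) : False := by
  obtain ⟨f, hf, hfi, hfa, hfb, hfim⟩ := D.arc_spec ha hb hab
  have hE : s(a, b) ∈ edgesIn G A := by
    refine ⟨hab, fun x hx => ?_⟩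
    rcases Sym2.mem_iff.1 hx with rfl | rfl <;> assumption
  obtain ⟨Z, hZ1, hZ2, hZa, hZb, hZ3⟩ := D.walk_image w hw
  have hwE : {e | e ∈ w.edges} ⊆ edgesIn G A := by
    intro e he
    refine ⟨w.edges_subset_edgeSet he, fun y hy => hw y ?_⟩
    obtain ⟨y', rfl⟩ := hy
    exact w.fst_mem_support_of_mem_edges he
  set K0 := D.part A (edgesIn G A \ {s(a, b)}) with hK0
  have hK0c : IsCompact K0 := D.part_compact A Set.sdiff_subset
  have hZK0 : Z ⊆ K0 := by
    intro z hz
    rcases hZ3 hz with ⟨y, hy, rfl⟩ | hz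
    · exact Or.inl ⟨y, hw y hy, rfl⟩
    · simp only [Set.mem_iUnion, exists_prop] at hz
      obtain ⟨e, he, hz⟩ := hz
      exact Or.inr (Set.mem_biUnion (x := e) ⟨hwE he, fun h => hew (h ▸ he)⟩ hz)
  -- intersection of the arc with the rest of the drawing
  have hK0arc : ∀ z ∈ D.arc s(a, b), z ∈ K0 → z = f 0 ∨ z = f 1 := by
    intro z hz hzK
    obtain ⟨v, hv, rfl, h1, -⟩ := D.part_inter (S := ∅) (T := {s(a, b)}) (by simp) subset_rfl
      (by simpa using hE) Set.sdiff_subset Set.disjoint_sdiff_right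
      (Or.inr (by simpa using hz)) hzK
    simp only [Set.mem_empty_iff_false, Set.mem_singleton_iff, exists_eq_left, false_or,
      Sym2.mem_iff] at h1
    rcases h1 with rfl | rfl
    · exact Or.inl hfa.symm
    · exact Or.inr hfb.symm
  have hI1 : Set.Icc (0 : ℝ) (1/4) ⊆ Set.Icc 0 1 := Set.Icc_subset_Icc le_rfl (by norm_num)
  have hI2 : Set.Icc (3/4 : ℝ) 1 ⊆ Set.Icc 0 1 := Set.Icc_subset_Icc (by norm_num) le_rfl
  set Y := K0 ∪ (f '' Set.Icc 0 (1/4) ∪ f '' Set.Icc (3/4) 1) with hY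
  have hYc : IsCompact Y := hK0c.union ((isCompact_Icc.image_of_continuousOn (hf.mono hI1)).union
    (isCompact_Icc.image_of_continuousOn (hf.mono hI2)))
  set X := D.arc s(a, b) ∪ Z with hX
  have hXc : IsCompact X := (D.arc_compact hE).union hZ2
  have hmI : (1/2 : ℝ) ∈ Set.Icc (0 : ℝ) 1 := by constructor <;> norm_num
  have hmarc : f (1/2) ∈ D.arc s(a, b) := hfim ▸ ⟨_, hmI, rfl⟩
  have hmY : f (1/2) ∉ Y := by
    rintro (h | ⟨y, hy, h⟩ | ⟨y, hy, h⟩)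
    · rcases hK0arc _ hmarc h with h | h
      · have := hfi hmI (by simp) h
        norm_num at this
      · have := hfi hmI (by simp) h
        norm_num at this
    · have := hfi (hI1 hy) hmI h
      rw [this] at hy
      have := hy.2
      norm_num at this
    · have := hfi (hI2 hy) hmI h
      rw [this] at hy
      have := hy.1
      norm_num at this
  obtain ⟨p, hp, q, hq, hpqY⟩ := exists_near hYc.isClosed hmY (hedge0 hmarc) (hedge1 hmarc)
  have hXim : X ⊆ D.image := by
    rintro z (hz | hz)
    · exact Or.inr (Set.mem_biUnion (x := s(a, b)) hE hz)
    · rcases hZK0 hz with h | h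
      · exact Or.inl h
      · simp only [Set.mem_iUnion, exists_prop] at h
        obtain ⟨e, he, h⟩ := h
        exact Or.inr (Set.mem_biUnion (x := e) he.1 h)
  have hxX : D.pos x ∉ X := by
    rintro (h | h)
    · have := D.pos_arc hE.1 hE.2 x hx h
      rcases Sym2.mem_iff.1 this with h | h
      · exact hxa h
      · exact hxb h
    · rcases hZ3 h with ⟨y, hy, h⟩ | h
      · have := D.pos_inj (hw y hy) hx h
        subst this
        exact hxw hy
      · simp only [Set.mem_iUnion, exists_prop] at h
        obtain ⟨e, he, h⟩ := h
        obtain ⟨y', rfl⟩ := D.pos_arc (hwE he).1 (hwE he).2 x hx h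
        exact hxw (w.fst_mem_support_of_mem_edges he)
  have hpqX : NotSep X p q := by
    have hUo : IsOpen (connectedComponentIn Xᶜ (D.pos x)) :=
      hXc.isClosed.isOpen_compl.connectedComponentIn
    have hxU : D.pos x ∈ connectedComponentIn Xᶜ (D.pos x) := mem_connectedComponentIn hxX
    obtain ⟨p', hp'1, hp'2⟩ := mem_closure_iff.1 (frontier_subset_closure h0) _ hUo hxU
    obtain ⟨q', hq'1, hq'2⟩ := mem_closure_iff.1 (frontier_subset_closure h1) _ hUo hxU
    refine ⟨(F0 ∪ connectedComponentIn Xᶜ (D.pos x)) ∪ F1, ?_, ?_, Or.inl (Or.inl hp), Or.inr hq⟩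
    · exact ((D.face_preconnected hF0).union p' hp'2 hp'1
        isPreconnected_connectedComponentIn).union q' (Or.inr hq'1) hq'2 (D.face_preconnected hF1)
    · rintro z ((hz | hz) | hz) hzX
      · exact D.face_subset hF0 hz (hXim hzX)
      · exact connectedComponentIn_subset _ _ hz hzX
      · exact D.face_subset hF1 hz (hXim hzX)
  have hXY : X ∩ Y = (f '' Set.Icc 0 (1/4) ∪ Z) ∪ f '' Set.Icc (3/4) 1 := by
    apply Set.Subset.antisymm
    · rintro z ⟨hz | hz, hzY⟩
      · rcases hzY with h | h | h
        · rcases hK0arc z hz h with rfl | rfl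
          · exact Or.inl (Or.inl ⟨0, by norm_num, rfl⟩)
          · exact Or.inr ⟨1, by norm_num, rfl⟩
        · exact Or.inl (Or.inl h)
        · exact Or.inr h
      · exact Or.inl (Or.inr hz)
    · rintro z ((hz | hz) | hz)
      · exact ⟨Or.inl (hfim ▸ Set.image_mono hI1 hz), Or.inr (Or.inl hz)⟩
      · exact ⟨Or.inr hz, Or.inl (hZK0 hz)⟩
      · exact ⟨Or.inl (hfim ▸ Set.image_mono hI2 hz), Or.inr (Or.inr hz)⟩
  have hXYc : IsPreconnected (X ∩ Y) := by
    rw [hXY]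
    refine IsPreconnected.union (D.pos b) (Or.inr hZb) ⟨1, by norm_num, hfb⟩ ?_
      (isPreconnected_Icc.image _ (hf.mono hI2))
    exact IsPreconnected.union (D.pos a) ⟨0, by norm_num, hfa⟩ hZa
      (isPreconnected_Icc.image _ (hf.mono hI1)) hZ1
  have hfin := janiszewski hXc hYc hXYc hpqX hpqY
  refine hne (D.face_eq_of_notSep hF0 hF1 hp hq (hfin.mono ?_))
  rintro z (hz | hz)
  · exact Or.inr (Or.inl (Or.inl hz))
  · simp only [Set.mem_iUnion, exists_prop] at hz
    obtain ⟨e, he, hz⟩ := hz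
    by_cases hee : e = s(a, b)
    · subst hee
      exact Or.inl (Or.inl hz)
    · exact Or.inr (Or.inl (Or.inr (Set.mem_biUnion (x := e) ⟨he, hee⟩ hz)))

/-- If `{s,t}` separates `a` from `b` after removing the edge `ab`, each face at `ab` contains
`s` or `t` on its boundary. -/
theorem hits [Finite W] (D : PlanarDrawingOn G A) {a b s t : W} (ha : a ∈ A) (hb : b ∈ A)
    (hab : G.Adj a b) {F0 F1 : Set (ℝ × ℝ)} (hF0 : D.IsFace F0) (hF1 : D.IsFace F1)
    (hne : F0 ≠ F1) (hedge0 : D.arc s(a, b) ⊆ frontier F0) (hedge1 : D.arc s(a, b) ⊆ frontier F1)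
    (A' : Set W) (haA' : a ∈ A') (hbA' : b ∉ A') (hbs : b ≠ s) (hbt : b ≠ t)
    (hcl : ∀ u ∈ A', ∀ v ∈ A, G.Adj u v → s(u, v) ≠ s(a, b) → v ∈ A' ∨ v = s ∨ v = t) :
    D.pos s ∈ frontier F0 ∨ D.pos t ∈ frontier F0 := by
  by_contra hcon
  rw [not_or] at hcon
  obtain ⟨hs, ht⟩ := hcon
  obtain ⟨f, hf, hfi, hfa, hfb, hfim⟩ := D.arc_spec ha hb hab
  have hE : s(a, b) ∈ edgesIn G A := by
    refine ⟨hab, fun x hx => ?_⟩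
    rcases Sym2.mem_iff.1 hx with rfl | rfl <;> assumption
  set Ta : Set (Sym2 W) := {e | e ∈ edgesIn G A ∧ e ≠ s(a, b) ∧ ∃ v ∈ e, v ∈ A'} with hTa
  set Tb : Set (Sym2 W) := {e | e ∈ edgesIn G A ∧ e ≠ s(a, b) ∧ ∀ v ∈ e, v ∉ A'} with hTb
  have hTaE : Ta ⊆ edgesIn G A := fun e he => he.1
  have hTbE : Tb ⊆ edgesIn G A := fun e he => he.1
  have hTav : ∀ e ∈ Ta, ∀ v ∈ e, v ∈ A' ∨ v = s ∨ v = t := by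
    rintro e ⟨h1, h2, u, hu, huA⟩ v hv
    by_cases huv : v = u
    · exact Or.inl (huv ▸ huA)
    · have he : e = s(u, v) := ((Sym2.mem_and_mem_iff (Ne.symm huv)).1 ⟨hu, hv⟩)
      subst he
      exact hcl u huA v (h1.2 v (by simp)) h1.1 h2
  set Ka := D.part (A ∩ A') Ta with hKa
  set Kb := D.part (A \ A') Tb with hKb
  have hKac : IsCompact Ka := D.part_compact _ hTaE
  have hKbc : IsCompact Kb := D.part_compact _ hTbE
  have hKab : ∀ z ∈ Ka, z ∈ Kb → z = D.pos s ∨ z = D.pos t := by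
    intro z hza hzb
    obtain ⟨v, hv, rfl, h1, h2⟩ := D.part_inter Set.inter_subset_left Set.sdiff_subset hTaE hTbE
      (Set.disjoint_left.2 (fun e he he' => by
        obtain ⟨v, hv, hv'⟩ := he.2.2
        exact he'.2.2 v hv hv')) hza hzb
    have hvA' : v ∉ A' := by
      rcases h2 with h2 | ⟨e, he, hve⟩
      · exact h2.2
      · exact he.2.2 v hve
    have : v ∈ A' ∨ v = s ∨ v = t := by
      rcases h1 with h1 | ⟨e, he, hve⟩
      · exact Or.inl h1.2
      · exact hTav e he v hve
    rcases this with h | rfl | rfl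
    · exact absurd h hvA'
    · exact Or.inl rfl
    · exact Or.inr rfl
  have harc : ∀ z ∈ D.arc s(a, b), ∀ S T, S ⊆ A → T ⊆ edgesIn G A → s(a, b) ∉ T →
      z ∈ D.part S T → ∃ v, z = D.pos v ∧ (v = a ∨ v = b) ∧ (v ∈ S ∨ ∃ e ∈ T, v ∈ e) := by
    intro z hz S T hS hT hT' hzK
    obtain ⟨v, hv, rfl, h1, h2⟩ := D.part_inter (S := ∅) (T := {s(a, b)}) (by simp) hS
      (by simpa using hE) hT (by simpa using hT')
      (Or.inr (by simpa using hz)) hzK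
    refine ⟨v, rfl, by simpa using h1, h2⟩
  have hKaarc : ∀ z ∈ D.arc s(a, b), z ∈ Ka → z = f 0 := by
    intro z hz hzK
    obtain ⟨v, rfl, rfl | rfl, h⟩ := harc z hz _ _ Set.inter_subset_left hTaE
      (fun h => h.2.1 rfl) hzK
    · exact hfa.symm
    · exfalso
      have : v ∈ A' ∨ v = s ∨ v = t := by
        rcases h with h1 | ⟨e, he, hve⟩
        · exact Or.inl h1.2
        · exact hTav e he v hve
      rcases this with h | h | h
      · exact hbA' h
      · exact hbs h
      · exact hbt h
  have hKbarc : ∀ z ∈ D.arc s(a, b), z ∈ Kb → z = f 1 := by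
    intro z hz hzK
    obtain ⟨v, rfl, rfl | rfl, h⟩ := harc z hz _ _ Set.sdiff_subset hTbE
      (fun h => h.2.1 rfl) hzK
    · exfalso
      rcases h with h1 | ⟨e, he, hve⟩
      · exact h1.2 haA'
      · exact he.2.2 v hve haA'
    · exact hfb.symm
  have hI1 : Set.Icc (0 : ℝ) (1/4) ⊆ Set.Icc 0 1 := Set.Icc_subset_Icc le_rfl (by norm_num)
  have hI2 : Set.Icc (3/4 : ℝ) 1 ⊆ Set.Icc 0 1 := Set.Icc_subset_Icc (by norm_num) le_rfl
  have hI3 : Set.Icc (1/4 : ℝ) (3/4) ⊆ Set.Icc 0 1 :=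
    Set.Icc_subset_Icc (by norm_num) (by norm_num)
  have hinarc : ∀ y ∈ Set.Icc (0 : ℝ) 1, f y ∈ D.arc s(a, b) := fun y hy => hfim ▸ ⟨y, hy, rfl⟩
  -- `f y` in `Ka` forces `y = 0`, in `Kb` forces `y = 1`
  have hy0 : ∀ y ∈ Set.Icc (0 : ℝ) 1, f y ∈ Ka → y = 0 := fun y hy h =>
    hfi hy (by simp) (hKaarc _ (hinarc y hy) h)
  have hy1 : ∀ y ∈ Set.Icc (0 : ℝ) 1, f y ∈ Kb → y = 1 := fun y hy h =>
    hfi hy (by simp) (hKbarc _ (hinarc y hy) h)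
  set X := (frontier F0 ∩ Ka) ∪ f '' Set.Icc 0 (1/4) with hX
  set Y := (frontier F0 ∩ Kb) ∪ f '' Set.Icc (3/4) 1 with hY
  set M := f '' Set.Icc (1/4) (3/4) with hM
  have hXc : IsCompact X := (hKac.inter_left isClosed_frontier).union
    (isCompact_Icc.image_of_continuousOn (hf.mono hI1))
  have hYc : IsCompact Y := (hKbc.inter_left isClosed_frontier).union
    (isCompact_Icc.image_of_continuousOn (hf.mono hI2))
  have hMc : IsCompact M := isCompact_Icc.image_of_continuousOn (hf.mono hI3)
  have hmI : (1/2 : ℝ) ∈ Set.Icc (0 : ℝ) 1 := by constructor <;> norm_num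
  have hm : f (1/2) ∉ X ∪ Y := by
    rintro ((⟨-, h⟩ | ⟨y, hy, h⟩) | (⟨-, h⟩ | ⟨y, hy, h⟩))
    · have := hy0 _ hmI h
      norm_num at this
    · have := hfi (hI1 hy) hmI h
      rw [this] at hy
      have := hy.2
      norm_num at this
    · have := hy1 _ hmI h
      norm_num at this
    · have := hfi (hI2 hy) hmI h
      rw [this] at hy
      have := hy.1
      norm_num at this
  obtain ⟨p, hp, q, hq, hpq⟩ := exists_near (hXc.union hYc).isClosed hm
    (hedge0 (hinarc _ hmI)) (hedge1 (hinarc _ hmI))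
  have harcim : D.arc s(a, b) ⊆ D.image := fun z hz =>
    Or.inr (Set.mem_biUnion (x := s(a, b)) hE hz)
  have hMarc : M ⊆ D.arc s(a, b) := hfim ▸ Set.image_mono hI3
  have hpqM : NotSep M p q := arc_notSep (by norm_num) (hf.mono hI3) (hfi.mono hI3)
    (fun h => D.face_subset hF0 hp (harcim (hMarc h)))
    (fun h => D.face_subset hF1 hq (harcim (hMarc h)))
  have hXM : (X ∩ M).Subsingleton := by
    have : ∀ z ∈ X ∩ M, z = f (1/4) := by
      rintro z ⟨⟨-, h⟩ | ⟨y, hy, rfl⟩, y', hy', h'⟩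
      · subst h'
        have := hy0 _ (hI3 hy') h
        rw [this] at hy'
        have := hy'.1
        norm_num at this
      · have := hfi (hI3 hy') (hI1 hy) h'
        subst this
        rw [le_antisymm hy.2 hy'.1]
    intro z hz z' hz'
    rw [this z hz, this z' hz']
  have hpqXM : NotSep (X ∪ M) p q := janiszewski hXc hMc hXM.isPreconnected
    (hpq.mono Set.subset_union_left) hpqM
  have hXMY : ((X ∪ M) ∩ Y).Subsingleton := by
    have : ∀ z ∈ (X ∪ M) ∩ Y, z = f (3/4) := by
      rintro z ⟨(⟨hz, hza⟩ | ⟨y, hy, rfl⟩) | ⟨y, hy, rfl⟩, (⟨hz', hzb⟩ | ⟨y', hy', h'⟩)⟩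
      · rcases hKab z hza hzb with rfl | rfl
        · exact absurd hz hs
        · exact absurd hz ht
      · subst h'
        have := hy0 _ (hI2 hy') hza
        rw [this] at hy'
        have := hy'.1
        norm_num at this
      · have := hy1 _ (hI1 hy) hzb
        rw [this] at hy
        have := hy.2
        norm_num at this
      · have := hfi (hI2 hy') (hI1 hy) h'
        subst this
        have := hy'.1.trans hy.2
        norm_num at this
      · have := hy1 _ (hI3 hy) hzb
        rw [this] at hy
        have := hy.2
        norm_num at this
      · have := hfi (hI2 hy') (hI3 hy) h'
        subst this
        rw [le_antisymm hy.2 hy'.1]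
    intro z hz z' hz'
    rw [this z hz, this z' hz']
  have hfin := janiszewski (hXc.union hMc) hYc hXMY.isPreconnected hpqXM
    (hpq.mono Set.subset_union_right)
  have hfr : frontier F0 ⊆ (X ∪ M) ∪ Y := by
    intro z hz
    rcases D.frontier_face_subset hF0 hz with ⟨v, hv, rfl⟩ | hz'
    · by_cases hvA' : v ∈ A'
      · exact Or.inl (Or.inl (Or.inl ⟨hz, Or.inl ⟨v, ⟨hv, hvA'⟩, rfl⟩⟩))
      · exact Or.inr (Or.inl ⟨hz, Or.inl ⟨v, ⟨hv, hvA'⟩, rfl⟩⟩)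
    · simp only [Set.mem_iUnion, exists_prop] at hz'
      obtain ⟨e, he, hze⟩ := hz'
      by_cases hee : e = s(a, b)
      · subst hee
        rw [← hfim] at hze
        obtain ⟨y, hy, rfl⟩ := hze
        rcases le_total y (1/4) with h | h
        · exact Or.inl (Or.inl (Or.inr ⟨y, ⟨hy.1, h⟩, rfl⟩))
        · rcases le_total y (3/4) with h' | h'
          · exact Or.inl (Or.inr ⟨y, ⟨h, h'⟩, rfl⟩)
          · exact Or.inr (Or.inr ⟨y, ⟨h', hy.2⟩, rfl⟩)
      · by_cases hx : ∃ v ∈ e, v ∈ A'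
        · exact Or.inl (Or.inl (Or.inl ⟨hz, Or.inr (Set.mem_biUnion (x := e) ⟨he, hee, hx⟩ hze)⟩))
        · push Not at hx
          exact Or.inr (Or.inl ⟨hz, Or.inr (Set.mem_biUnion (x := e) ⟨he, hee, hx⟩ hze)⟩)
  obtain ⟨T, hT, hTf, hpT, hqT⟩ := hfin.mono hfr
  have hqF0 : q ∉ F0 := fun h => hne (D.face_eq_of_notSep hF0 hF1 h hq
    ⟨F1, D.face_preconnected hF1, D.face_subset hF1, hq, hq⟩)
  have hF0o := D.face_open hF0
  obtain ⟨z, -, hz1, hz2⟩ := hT F0 (closure F0)ᶜ hF0o isClosed_closure.isOpen_compl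
    (fun z hz => by
      by_contra hcon
      rw [Set.mem_union, not_or, Set.notMem_compl_iff] at hcon
      exact hTf hz (by rw [hF0o.frontier_eq]; exact ⟨hcon.2, hcon.1⟩))
    ⟨p, hpT, hp⟩ ⟨q, hqT, fun h => hTf hqT (by rw [hF0o.frontier_eq]; exact ⟨h, hqF0⟩)⟩
  exact hz2 (subset_closure hz1)

end PlanarDrawingOn

/-! ### Combinatorial part -/

section Comb

variable {W : Type*} {G : SimpleGraph W} {A : Set W}

theorem ReachableWithin.rfl' {u : W} (hu : u ∈ A) : ReachableWithin G A u u :=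
  ⟨SimpleGraph.Walk.nil, by simpa using hu⟩

theorem ReachableWithin.symm' {u v : W} (h : ReachableWithin G A u v) :
    ReachableWithin G A v u := by
  obtain ⟨p, hp⟩ := h
  exact ⟨p.reverse, by simpa using hp⟩

theorem ReachableWithin.trans' {u v w : W} (h : ReachableWithin G A u v)
    (h' : ReachableWithin G A v w) : ReachableWithin G A u w := by
  obtain ⟨p, hp⟩ := h
  obtain ⟨q, hq⟩ := h'
  refine ⟨p.append q, fun x hx => ?_⟩
  rw [SimpleGraph.Walk.mem_support_append_iff] at hx
  exact hx.elim (hp x) (hq x)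

theorem ReachableWithin.mem_right {u v : W} (h : ReachableWithin G A u v) : v ∈ A := by
  obtain ⟨p, hp⟩ := h
  exact hp _ p.end_mem_support

theorem ReachableWithin.mem_left {u v : W} (h : ReachableWithin G A u v) : u ∈ A := by
  obtain ⟨p, hp⟩ := h
  exact hp _ p.start_mem_support

theorem ReachableWithin.mono' {A' : Set W} (hA : A ⊆ A') {u v : W} (h : ReachableWithin G A u v) :
    ReachableWithin G A' u v := by
  obtain ⟨p, hp⟩ := h
  exact ⟨p, fun x hx => hA (hp x hx)⟩

theorem ReachableWithin.of_adj {u v : W} (hu : u ∈ A) (hv : v ∈ A) (h : G.Adj u v) :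
    ReachableWithin G A u v := by
  refine ⟨h.toWalk, fun x hx => ?_⟩
  simp at hx
  rcases hx with rfl | rfl <;> assumption

/-- Transfer of reachability: enough to treat single edges. -/
theorem ReachableWithin.transfer {G' : SimpleGraph W}
    (h : ∀ u ∈ A, ∀ v ∈ A, G'.Adj u v → ReachableWithin G A u v) {u v : W}
    (huv : ReachableWithin G' A u v) : ReachableWithin G A u v := by
  obtain ⟨p, hp⟩ := huv
  induction p with
  | nil => exact ReachableWithin.rfl' (hp _ (by simp))
  | @cons u u' v hadj p ih =>
    exact (h u (hp _ (by simp)) u' (hp _ (by simp)) hadj).trans'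
      (ih (fun x hx => hp x (by simp [hx])))

theorem reach_exit {S L : Set W} {v : W} {z : W}
    (hcl : ∀ y ∈ L, ∀ y' ∈ S, G.Adj y y' → y' ∈ L ∨ y' = v) (hz : z ∈ L)
    (h : ReachableWithin G S z v) : ReachableWithin G (L ∪ {v}) z v := by
  obtain ⟨p, hp⟩ := h
  induction p with
  | nil => exact ReachableWithin.rfl' (Or.inl hz)
  | @cons u u' v hadj p ih =>
    by_cases hu' : u' = v
    · subst hu'
      exact ReachableWithin.of_adj (Or.inl hz) (Or.inr rfl) hadj
    · have hL : u' ∈ L := (hcl u hz u' (hp _ (by simp)) hadj).resolve_right hu'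
      exact (ReachableWithin.of_adj (A := L ∪ {v}) (Or.inl hz) (Or.inl hL) hadj).trans'
        (ih hcl hL (fun x hx => hp x (by simp [hx])))

theorem addEdge_adj {a b u v : W} (h : (addEdge G a b).Adj u v) :
    G.Adj u v ∨ s(u, v) = s(a, b) := by
  rw [addEdge, SimpleGraph.sup_adj, SimpleGraph.fromEdgeSet_adj] at h
  exact h.imp id (fun h => h.1)

theorem le_addEdge (a b : W) : G ≤ addEdge G a b := le_sup_left

theorem threePaths_mono {G' : SimpleGraph W} (hle : G ≤ G') {s t : W}
    (h : ThreePathsOn G A s t) : ThreePathsOn G' A s t := by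
  obtain ⟨p₁, p₂, p₃, h1, h2, h3, h4, h5, h6, h7, h8, h9, h10, h11, h12⟩ := h
  have hinj : Function.Injective (fun p : G.Walk s t => p.mapLe hle) :=
    SimpleGraph.Walk.map_injective_of_injective (Function.injective_id) s t
  refine ⟨p₁.mapLe hle, p₂.mapLe hle, p₃.mapLe hle, h1.mapLe hle, h2.mapLe hle, h3.mapLe hle,
    by simpa using h4, by simpa using h5, by simpa using h6, hinj.ne h7, hinj.ne h8,
    hinj.ne h9, ?_, ?_, ?_⟩
  · simpa [IntDisjoint] using h10
  · simpa [IntDisjoint] using h11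
  · simpa [IntDisjoint] using h12

/-- Two vertices of a triconnected component are not separated by a 3-connected pair. -/
theorem tri_reach {B R : Set W} (hR : R.Pairwise (SameTriCompOn G B)) (hRB : R ⊆ B)
    {s t x y : W} (hst : TriSepPairOn G B s t) (hx : x ∈ R) (hy : y ∈ R)
    (hx' : x ∉ ({s, t} : Set W)) (hy' : y ∉ ({s, t} : Set W)) :
    ReachableWithin G (B \ {s, t}) x y := by
  by_cases hxy : x = y
  · subst hxy
    exact ReachableWithin.rfl' ⟨hRB hx, hx'⟩
  · by_contra hcon
    exact (hR hx hy hxy).2.2 s t hst ⟨⟨hRB hx, hx'⟩, ⟨hRB hy, hy'⟩, hcon⟩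

theorem pair_separates {B R R' Rab : Set W} {a b s t : W}
    (hR : IsTriCompOn G B R) (hR' : IsTriCompOn G B R') (hne : R ≠ R')
    (hRab : IsTriCompOn (addEdge G a b) B Rab) (hsub : R ⊆ Rab) (hsub' : R' ⊆ Rab)
    (ha : a ∈ B) (hb : b ∈ B)
    (hst : TriSepPairOn G B s t) (hs : s ∈ R) (ht : t ∈ R) (hs' : s ∈ R') (ht' : t ∈ R') :
    SeparatesOn G B s t a b := by
  by_contra hcon
  have htr : ∀ u v, ReachableWithin (addEdge G a b) (B \ {s, t}) u v →
      ReachableWithin G (B \ {s, t}) u v := by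
    intro u v huv
    refine ReachableWithin.transfer ?_ huv
    intro u hu v hv hadj
    rcases addEdge_adj hadj with h | h
    · exact ReachableWithin.of_adj hu hv h
    · have key : a ∈ B \ {s, t} → b ∈ B \ {s, t} → ReachableWithin G (B \ {s, t}) a b := by
        intro h1 h2
        by_contra h3
        exact hcon ⟨h1, h2, h3⟩
      rcases Sym2.eq_iff.1 h with ⟨rfl, rfl⟩ | ⟨rfl, rfl⟩
      · exact key hu hv
      · exact (key hv hu).symm'
  have hst' : TriSepPairOn (addEdge G a b) B s t := by
    refine ⟨⟨hst.1.1, hst.1.2.1, hst.1.2.2.1, hst.1.2.2.2.1, fun h => hst.1.2.2.2.2 ?_⟩,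
      threePaths_mono (le_addEdge a b) hst.2⟩
    exact ⟨h.1, fun u hu v hv => htr u v (h.2 hu hv)⟩
  -- the union is not pairwise unseparated
  have hnp : ¬ (R ∪ R').Pairwise (SameTriCompOn G B) := by
    intro h
    have h1 := hR.2.2 (R ∪ R') Set.subset_union_left (Set.union_subset hR.1 hR'.1) h
    have h2 := hR'.2.2 (R ∪ R') Set.subset_union_right (Set.union_subset hR.1 hR'.1) h
    exact hne (h1.symm.trans h2)
  -- key claim
  have key : ∀ x ∈ R, ∀ y ∈ R', ∀ s' t', TriSepPairOn G B s' t' → x ∈ B \ {s', t'} →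
      y ∈ B \ {s', t'} → ReachableWithin G (B \ {s', t'}) x y := by
    intro x hx y hy s' t' hst1 hxB hyB
    by_cases h1 : s ∈ ({s', t'} : Set W)
    · by_cases h2 : t ∈ ({s', t'} : Set W)
      · have heq : ({s', t'} : Set W) = {s, t} := by
          have hne' := hst.1.2.2.1
          simp only [Set.mem_insert_iff, Set.mem_singleton_iff] at h1 h2
          rcases h1 with rfl | rfl <;> rcases h2 with rfl | rfl
          · exact absurd rfl hne'
          · rfl
          · exact Set.pair_comm _ _
          · exact absurd rfl hne'
        rw [heq] at hxB hyB ⊢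
        exact htr x y (tri_reach hRab.2.1 hRab.1 hst' (hsub hx) (hsub' hy) hxB.2 hyB.2)
      · exact (tri_reach hR.2.1 hR.1 hst1 hx ht hxB.2 h2).trans'
          (tri_reach hR'.2.1 hR'.1 hst1 ht' hy h2 hyB.2)
    · exact (tri_reach hR.2.1 hR.1 hst1 hx hs hxB.2 h1).trans'
          (tri_reach hR'.2.1 hR'.1 hst1 hs' hy h1 hyB.2)
  apply hnp
  rintro x (hx | hx) y (hy | hy) hxy
  · exact hR.2.1 hx hy hxy
  · exact ⟨hR.1 hx, hR'.1 hy, fun s' t' h1 h2 => h2.2.2 (key x hx y hy s' t' h1 h2.1 h2.2.1)⟩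
  · exact ⟨hR'.1 hx, hR.1 hy,
      fun s' t' h1 h2 => h2.2.2 (key y hy x hx s' t' h1 h2.2.1 h2.1).symm'⟩
  · exact hR'.2.1 hx hy hxy

/-- A virtual edge can be replaced by a path of `G` avoiding the rest of the component. -/
theorem virtual_reach {G' : SimpleGraph W} (hle : G ≤ G') {B R : Set W}
    (hB : BiconnectedOn G B) (hRB : R ⊆ B) (hR : R.Pairwise (SameTriCompOn G' B))
    {u v s t : W} (huv : TriSepPairOn G' B u v) (hu : u ∈ R) (hv : v ∈ R) (hs : s ∈ R)
    (ht : t ∈ R) (hu' : u ∉ ({s, t} : Set W)) (hv' : v ∉ ({s, t} : Set W)) :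
    ReachableWithin G (B \ {s, t}) u v := by
  have hne : u ≠ v := huv.1.2.2.1
  have hsuv : s ∉ ({u, v} : Set W) := by
    rintro (h | h)
    · exact hu' (Or.inl h.symm)
    · exact hv' (Or.inl h.symm)
  have htuv : t ∉ ({u, v} : Set W) := by
    rintro (h | h)
    · exact hu' (Or.inr h.symm)
    · exact hv' (Or.inr h.symm)
  obtain ⟨z, hz, hzs⟩ : ∃ z ∈ B \ {u, v}, ¬ ReachableWithin G' (B \ {u, v}) z s := by
    by_contra! hcon
    exact huv.1.2.2.2.2 ⟨huv.1.2.2.2.1, fun x hx y hy => (hcon x hx).trans' (hcon y hy).symm'⟩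
  set L : Set W := {y | ReachableWithin G' (B \ {u, v}) z y} with hL
  have hzL : z ∈ L := ReachableWithin.rfl' hz
  have hLB : L ⊆ B \ {u, v} := fun y hy => ReachableWithin.mem_right hy
  have hsL : s ∉ L := hzs
  have htL : t ∉ L := fun h =>
    hzs (ReachableWithin.trans' h (tri_reach hR hRB huv ht hs htuv hsuv))
  have hext : ∀ y ∈ L, ∀ y' ∈ B \ {u, v}, G.Adj y y' → y' ∈ L := fun y hy y' hy' hadj =>
    ReachableWithin.trans' hy (ReachableWithin.of_adj (hLB hy) hy' (hle hadj))
  have r1 : ReachableWithin G (L ∪ {v}) z v := by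
    have hc := hB.2 u (hRB hu) ⟨v, hRB hv, Ne.symm hne⟩
    refine reach_exit (S := B \ {u}) ?_ hzL
      (hc.2 ⟨hz.1, fun h => hz.2 (Or.inl h)⟩ ⟨hRB hv, Ne.symm hne⟩)
    intro y hy y' hy' hadj
    by_cases h : y' = v
    · exact Or.inr h
    · exact Or.inl (hext y hy y' ⟨hy'.1, fun h' => h'.elim hy'.2 h⟩ hadj)
  have r2 : ReachableWithin G (L ∪ {u}) z u := by
    have hc := hB.2 v (hRB hv) ⟨u, hRB hu, hne⟩
    refine reach_exit (S := B \ {v}) ?_ hzL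
      (hc.2 ⟨hz.1, fun h => hz.2 (Or.inr h)⟩ ⟨hRB hu, hne⟩)
    intro y hy y' hy' hadj
    by_cases h : y' = u
    · exact Or.inr h
    · exact Or.inl (hext y hy y' ⟨hy'.1, fun h' => h'.elim h hy'.2⟩ hadj)
  have hLst : L ⊆ B \ {s, t} := by
    intro y hy
    refine ⟨(hLB hy).1, ?_⟩
    rintro (rfl | rfl)
    · exact hsL hy
    · exact htL hy
  refine (r2.mono' (Set.union_subset hLst ?_)).symm'.trans'
    (r1.mono' (Set.union_subset hLst ?_))
  · rintro _ rfl
    exact ⟨hRB hu, hu'⟩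
  · rintro _ rfl
    exact ⟨hRB hv, hv'⟩

theorem triComp_edge_reach {B Rab : Set W} {a b s t u v : W} (hB : BiconnectedOn G B)
    (hRab : IsTriCompOn (addEdge G a b) B Rab)
    (hs : s ∈ Rab) (ht : t ∈ Rab) (h : (triCompGraph (addEdge G a b) B Rab).Adj u v)
    (hne : s(u, v) ≠ s(a, b))
    (hu' : u ∉ ({s, t} : Set W)) (hv' : v ∉ ({s, t} : Set W)) :
    ReachableWithin G (B \ {s, t}) u v := by
  rw [triCompGraph, SimpleGraph.fromRel_adj] at h
  have hR := hRab.2.1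
  have hRB := hRab.1
  have main : ∀ u v : W, u ∈ Rab → v ∈ Rab → s(u, v) ≠ s(a, b) → u ∉ ({s, t} : Set W) →
      v ∉ ({s, t} : Set W) → ((addEdge G a b).Adj u v ∨ TriSepPairOn (addEdge G a b) B u v) →
      ReachableWithin G (B \ {s, t}) u v := by
    intro u v hu hv hne hu' hv' h
    rcases h with h | h
    · rcases addEdge_adj h with h | h
      · exact ReachableWithin.of_adj ⟨hRB hu, hu'⟩ ⟨hRB hv, hv'⟩ h
      · exact absurd h hne
    · exact virtual_reach (le_addEdge a b) hB hRB hR h hu hv hs ht hu' hv'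
  rcases h.2 with ⟨h1, h2, h3⟩ | ⟨h1, h2, h3⟩
  · exact main u v h1 h2 hne hu' hv' h3
  · exact (main v u h1 h2 (by rwa [Sym2.eq_swap]) hv' hu' h3).symm'

/-- In a 3-connected graph, there is a cycle through `ab` avoiding a given third vertex. -/
theorem exists_avoiding_walk {a b x : W} (hG : KConnectedOn 3 G A) (ha : a ∈ A) (hb : b ∈ A)
    (hab : a ≠ b) (hxa : x ≠ a) (hxb : x ≠ b) :
    ∃ w : G.Walk a b, (∀ y ∈ w.support, y ∈ A) ∧ x ∉ w.support ∧ s(a, b) ∉ w.edges := by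
  classical
  obtain ⟨⟨f, hf, hfA⟩, hcon⟩ := hG
  obtain ⟨c, hcA, hc⟩ : ∃ c ∈ A, c ∉ ({a, b, x} : Finset W) := by
    by_contra! hall
    have h1 : Finset.univ.image f ⊆ ({a, b, x} : Finset W) := by
      intro y hy
      obtain ⟨i, -, rfl⟩ := Finset.mem_image.1 hy
      exact hall _ (hfA i)
    have h2 := Finset.card_le_card h1
    rw [Finset.card_image_of_injective _ hf] at h2
    have h3 : ({a, b, x} : Finset W).card ≤ 3 := Finset.card_le_three
    simp at h2
    omega
  simp only [Finset.mem_insert, Finset.mem_singleton, not_or] at hc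
  have hcard : ∀ y : W, ({x, y} : Set W).ncard < 3 := fun y =>
    lt_of_le_of_lt (Set.ncard_insert_le x {y}) (by simp)
  obtain ⟨w1, hw1⟩ := (hcon {x, a} (Set.toFinite _) (hcard a)).2
    (u := c) ⟨hcA, by simp [hc.1, hc.2.2]⟩ (v := b) ⟨hb, by simp [hxb.symm, hab.symm]⟩
  obtain ⟨w2, hw2⟩ := (hcon {x, b} (Set.toFinite _) (hcard b)).2
    (u := a) ⟨ha, by simp [hxa.symm, hab]⟩ (v := c) ⟨hcA, by simp [hc.2.1, hc.2.2]⟩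
  refine ⟨w2.append w1, ?_, ?_, ?_⟩
  · intro y hy
    rw [SimpleGraph.Walk.mem_support_append_iff] at hy
    exact hy.elim (fun h => (hw2 y h).1) (fun h => (hw1 y h).1)
  · intro hy
    rw [SimpleGraph.Walk.mem_support_append_iff] at hy
    exact hy.elim (fun h => (hw2 x h).2 (by simp)) (fun h => (hw1 x h).2 (by simp))
  · intro he
    rw [SimpleGraph.Walk.edges_append, List.mem_append] at he
    rcases he with he | he
    · exact (hw2 b (w2.snd_mem_support_of_mem_edges he)).2 (by simp)
    · exact (hw1 a (w1.fst_mem_support_of_mem_edges he)).2 (by simp)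

end Comb

/-- Two-colouring lemma: if `G + {a,b}` is planar and the rigid
components on the SPQR-tree path coalesce into a rigid component `Rab` of `G + {a,b}`,
then the two faces `F0, F1` of the embedding of `Rab` incident with the edge `{a,b}`
partition the separating-pair vertices, with the two vertices of each separating pair
in different parts. -/
theorem stmt2 {V : Type*} [Fintype V] (G : SimpleGraph V) (hplanar : G.IsPlanar)
    (B : Set V) (hB : IsBlock G B)
    (a b : V) (ha : a ∈ B) (hb : b ∈ B)
    (htri : ¬ SameTriCompOn G B a b)
    (k : ℕ) (sp : SPQRPathOn G B a b k)
    (hplanar' : (addEdge G a b).IsPlanar)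
    (Rab : Set V) (hRab : IsRigidCompOn (addEdge G a b) B Rab)
    (hsub : ∀ i, sp.R i ⊆ Rab)
    (D : PlanarDrawingOn (triCompGraph (addEdge G a b) B Rab) Rab)
    (F0 F1 : Set (ℝ × ℝ)) (hF0 : D.IsFace F0) (hF1 : D.IsFace F1) (hne : F0 ≠ F1)
    (hedge0 : D.arc s(a, b) ⊆ frontier F0) (hedge1 : D.arc s(a, b) ⊆ frontier F1) :
    (∀ x : V, (∃ i : Fin (k + 1), x = (sp.P i).1 ∨ x = (sp.P i).2) →
        (D.pos x ∈ frontier F0 ∨ D.pos x ∈ frontier F1) ∧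
        ¬ (D.pos x ∈ frontier F0 ∧ D.pos x ∈ frontier F1)) ∧
    (∀ i : Fin (k + 1),
        (D.pos (sp.P i).1 ∈ frontier F0 ∧ D.pos (sp.P i).2 ∈ frontier F1) ∨
        (D.pos (sp.P i).1 ∈ frontier F1 ∧ D.pos (sp.P i).2 ∈ frontier F0)) := by
  have hRT := hRab.1
  have hsep : ∀ i : Fin (k + 1), SeparatesOn G B (sp.P i).1 (sp.P i).2 a b := by
    intro i
    refine pair_separates (sp.rigid i.castSucc).1 (sp.rigid i.succ).1 ?_ hRT (hsub _) (hsub _)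
      ha hb (sp.sep i) (sp.linkL i).1 (sp.linkL i).2 (sp.linkR i).1 (sp.linkR i).2
    intro h
    have h1 := congrArg Fin.val (sp.R_inj h)
    simp at h1
  have haR : a ∈ Rab := hsub _ sp.ha
  have hbR : b ∈ Rab := hsub _ sp.hb
  have hab : a ≠ b := by
    rintro rfl
    obtain ⟨h1, h2, h3⟩ := hsep 0
    exact h3 (ReachableWithin.rfl' h1)
  have hadj : (triCompGraph (addEdge G a b) B Rab).Adj a b := by
    rw [triCompGraph, SimpleGraph.fromRel_adj]
    refine ⟨hab, Or.inl ⟨haR, hbR, Or.inl ?_⟩⟩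
    rw [addEdge, SimpleGraph.sup_adj, SimpleGraph.fromEdgeSet_adj]
    exact Or.inr ⟨rfl, hab⟩
  have hboth : ∀ x ∈ Rab, x ≠ a → x ≠ b →
      ¬ (D.pos x ∈ frontier F0 ∧ D.pos x ∈ frontier F1) := by
    rintro x hx hxa hxb ⟨h0, h1⟩
    obtain ⟨w, hw1, hw2, hw3⟩ := exists_avoiding_walk hRab.2 haR hbR hab hxa hxb
    exact D.not_both haR hbR hadj hF0 hF1 hne hedge0 hedge1 hx hxa hxb w hw1 hw2 hw3 h0 h1
  have hpair : ∀ i : Fin (k + 1),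
      ((D.pos (sp.P i).1 ∈ frontier F0 ∧ D.pos (sp.P i).2 ∈ frontier F1) ∨
        (D.pos (sp.P i).1 ∈ frontier F1 ∧ D.pos (sp.P i).2 ∈ frontier F0)) ∧
      ¬ (D.pos (sp.P i).1 ∈ frontier F0 ∧ D.pos (sp.P i).1 ∈ frontier F1) ∧
      ¬ (D.pos (sp.P i).2 ∈ frontier F0 ∧ D.pos (sp.P i).2 ∈ frontier F1) := by
    intro i
    have hsR : (sp.P i).1 ∈ Rab := hsub _ (sp.linkL i).1
    have htR : (sp.P i).2 ∈ Rab := hsub _ (sp.linkL i).2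
    obtain ⟨haS, hbS, hnr⟩ := hsep i
    set s := (sp.P i).1 with hs
    set t := (sp.P i).2 with ht
    have has : a ≠ s := fun h => haS.2 (Or.inl h)
    have hat : a ≠ t := fun h => haS.2 (Or.inr h)
    have hbs : b ≠ s := fun h => hbS.2 (Or.inl h)
    have hbt : b ≠ t := fun h => hbS.2 (Or.inr h)
    have hcl : ∀ u ∈ {u | ReachableWithin G (B \ {s, t}) a u}, ∀ v ∈ Rab,
        (triCompGraph (addEdge G a b) B Rab).Adj u v → s(u, v) ≠ s(a, b) →
        v ∈ {u | ReachableWithin G (B \ {s, t}) a u} ∨ v = s ∨ v = t := by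
      intro u hu v hv huv huvne
      by_cases hvst : v ∈ ({s, t} : Set V)
      · exact Or.inr hvst
      · exact Or.inl (ReachableWithin.trans' hu (triComp_edge_reach hB.1 hRT hsR htR huv huvne
          (ReachableWithin.mem_right hu).2 hvst))
    have k0 := D.hits haR hbR hadj hF0 hF1 hne hedge0 hedge1 _ (ReachableWithin.rfl' haS)
      hnr hbs hbt hcl
    have k1 := D.hits haR hbR hadj hF1 hF0 hne.symm hedge1 hedge0 _ (ReachableWithin.rfl' haS)
      hnr hbs hbt hcl
    have n1 := hboth s hsR has.symm hbs.symm
    have n2 := hboth t htR hat.symm hbt.symm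
    refine ⟨?_, n1, n2⟩
    tauto
  refine ⟨?_, fun i => (hpair i).1⟩
  rintro x ⟨i, rfl | rfl⟩
  · have := hpair i
    tauto
  · have := hpair i
    tauto
end
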